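/- arXiv:2605.06034 — 2 statements merged into one kernel-verified Lean document; each statement's English description precedes it below -/
import Mathlib

section
/- The identity ∑_{k=1}^∞ h_k^{(2)}·h_k²/k² = (315/128)·ζ(6) + (49/48)·ζ(3)² - (1/3)·∑_{k=1}^∞ h_k³/k³ holds, both series being convergent. -/
open Finset Real

noncomputable def H (k : ℕ) : ℝ := ∑ j ∈ Finset.range k, (1 : ℝ) / ((j : ℝ) + 1)
noncomputable def H2 (k : ℕ) : ℝ := ∑ j ∈ Finset.range k, (1 : ℝ) / ((j : ℝ) + 1) ^ 2
noncomputable def H3 (k : ℕ) : ℝ := ∑ j ∈ Finset.range k, (1 : ℝ) / ((j : ℝ) + 1) ^ 3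
noncomputable def h (k : ℕ) : ℝ := ∑ j ∈ Finset.range k, (1 : ℝ) / (2 * (j : ℝ) + 1)
noncomputable def h2 (k : ℕ) : ℝ := ∑ j ∈ Finset.range k, (1 : ℝ) / (2 * (j : ℝ) + 1) ^ 2
noncomputable def h3 (k : ℕ) : ℝ := ∑ j ∈ Finset.range k, (1 : ℝ) / (2 * (j : ℝ) + 1) ^ 3
noncomputable def zeta (s : ℕ) : ℝ := ∑' n : ℕ, (1 : ℝ) / ((n : ℝ) + 1) ^ s

/-- The ratios `h_K / K` with `K = k + 1`. -/
noncomputable def ratio (k : ℕ) : ℝ := h (k + 1) / ((k : ℝ) + 1)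

/-- Partial sums of the ratios `h_K / K`. -/
noncomputable def ratioSum (j : ℕ) : ℝ := ∑ k ∈ Finset.range j, ratio k

lemma h_zero : h 0 = 0 := by simp [h]

lemma h_succ (k : ℕ) : h (k + 1) = h k + 1 / (2 * (k : ℝ) + 1) := by
  simp [h, Finset.sum_range_succ]

lemma h2_succ (k : ℕ) : h2 (k + 1) = h2 k + 1 / (2 * (k : ℝ) + 1) ^ 2 := by
  simp [h2, Finset.sum_range_succ]

lemma ratioSum_succ (k : ℕ) : ratioSum (k + 1) = ratioSum k + ratio k := by
  simp [ratioSum, Finset.sum_range_succ]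

lemma h_nonneg (k : ℕ) : 0 ≤ h k := Finset.sum_nonneg fun _ _ => by positivity

lemma ratio_nonneg (k : ℕ) : 0 ≤ ratio k := div_nonneg (h_nonneg _) (by positivity)

lemma ratioSum_nonneg (k : ℕ) : 0 ≤ ratioSum k := Finset.sum_nonneg fun _ _ => ratio_nonneg _

lemma h_mono : Monotone h := monotone_nat_of_le_succ fun k => by
  rw [h_succ]; have : (0:ℝ) ≤ 1 / (2 * (k : ℝ) + 1) := by positivity
  linarith

lemma one_le_h_succ (k : ℕ) : 1 ≤ h (k + 1) := by
  calc (1 : ℝ) = h 1 := by simp [h]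
    _ ≤ _ := h_mono (by omega)

lemma sum_antidiagonal_inv_mul_inv (n : ℕ) :
    ∑ p ∈ Finset.HasAntidiagonal.antidiagonal n, 1 / (2 * (p.1 : ℝ) + 1) * (1 / (2 * (p.2 : ℝ) + 1)) = ratio n := by
  have e : ∀ p ∈ Finset.HasAntidiagonal.antidiagonal n, 1 / (2 * (p.1 : ℝ) + 1) * (1 / (2 * (p.2 : ℝ) + 1))
      = 1 / (2 * (n : ℝ) + 2) * (1 / (2 * (p.1 : ℝ) + 1) + 1 / (2 * (p.2 : ℝ) + 1)) := by
    intro p hp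
    have : (n : ℝ) = p.1 + p.2 := by exact_mod_cast (Finset.HasAntidiagonal.mem_antidiagonal.1 hp).symm
    rw [this]; field_simp; ring
  have e1 : ∑ p ∈ Finset.HasAntidiagonal.antidiagonal n, 1 / (2 * (p.1 : ℝ) + 1) = h (n + 1) := by
    rw [Finset.Nat.sum_antidiagonal_eq_sum_range_succ_mk]; rfl
  have e2 : ∑ p ∈ Finset.HasAntidiagonal.antidiagonal n, 1 / (2 * (p.2 : ℝ) + 1) = h (n + 1) := by
    rw [← e1, ← Finset.Nat.sum_antidiagonal_swap]; rfl
  rw [Finset.sum_congr rfl e, ← Finset.mul_sum, Finset.sum_add_distrib, e1, e2, ratio]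
  field_simp; ring

lemma sum_antidiagonal_h_div (n : ℕ) :
    ∑ p ∈ Finset.HasAntidiagonal.antidiagonal n, h (p.1 + 1) / (2 * (p.2 : ℝ) + 1) = ratioSum (n + 1) := by
  induction n with
  | zero => simp [ratioSum, ratio]
  | succ n ih =>
    rw [ratioSum_succ, ← ih, ← sum_antidiagonal_inv_mul_inv (n + 1)]
    simp_rw [h_succ, add_div]
    rw [Finset.sum_add_distrib]
    congr 1
    · rw [Finset.Nat.sum_antidiagonal_succ]
      simp [h_zero, h_succ, add_div]
    · exact Finset.sum_congr rfl fun _ _ => by ring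

lemma sum_antidiagonal_ratio_div (n : ℕ) :
    ∑ p ∈ Finset.HasAntidiagonal.antidiagonal n, ratio p.1 * (1 / (2 * (p.2 : ℝ) + 1))
      = 3 * ratioSum (n + 1) / (2 * (n : ℝ) + 3) := by
  have e : ∀ p ∈ Finset.HasAntidiagonal.antidiagonal n, ratio p.1 * (1 / (2 * (p.2 : ℝ) + 1))
      = 1 / (2 * (n : ℝ) + 3) * (2 * (h (p.1 + 1) / (2 * (p.2 : ℝ) + 1)) + ratio p.1) := by
    intro p hp
    have : (n : ℝ) = p.1 + p.2 := by exact_mod_cast (Finset.HasAntidiagonal.mem_antidiagonal.1 hp).symm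
    rw [this, ratio]; field_simp; ring
  rw [Finset.sum_congr rfl e, ← Finset.mul_sum, Finset.sum_add_distrib, ← Finset.mul_sum,
    sum_antidiagonal_h_div, Finset.Nat.sum_antidiagonal_eq_sum_range_succ_mk]
  change _ * (_ + ratioSum (n + 1)) = _
  ring

lemma hasSum_of_eq {ι α : Type*} [AddCommMonoid α] [TopologicalSpace α] {f g : ι → α} {a b : α}
    (hf : HasSum f a) (e : ∀ n, g n = f n) (e' : b = a) : HasSum g b := by
  rw [e', funext e]; exact hf

lemma hasSum_artanh {x : ℝ} (hx : x ∈ Set.Ioo (0:ℝ) 1) :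
    HasSum (fun j : ℕ => 1 / (2 * (j : ℝ) + 1) * x ^ (2 * j + 1)) (artanh x) := by
  have := (Real.hasSum_log_sub_log_of_abs_lt_one (x := x)
    (by rw [abs_lt]; constructor <;> linarith [hx.1, hx.2])).mul_left (1 / 2)
  rw [artanh_eq_half_log ⟨by linarith [hx.1], hx.2.le⟩, Real.log_div (by linarith [hx.1]) (by linarith [hx.2])]
  exact hasSum_of_eq this (fun _ => by ring) (by ring)

/-- The Cauchy product of two nonnegative power series. -/
lemma hasSum_cauchyProduct {f g : ℕ → ℝ} {a b : ℝ} (hf : HasSum f a) (hg : HasSum g b)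
    (hf0 : ∀ n, 0 ≤ f n) (hg0 : ∀ n, 0 ≤ g n) :
    HasSum (fun n => ∑ p ∈ Finset.HasAntidiagonal.antidiagonal n, f p.1 * g p.2) (a * b) := by
  have hf' : Summable fun n => ‖f n‖ := by simpa [abs_of_nonneg, hf0] using hf.summable
  have hg' : Summable fun n => ‖g n‖ := by simpa [abs_of_nonneg, hg0] using hg.summable
  have e := tsum_mul_tsum_eq_tsum_sum_antidiagonal_of_summable_norm hf' hg'
  rw [hf.tsum_eq, hg.tsum_eq] at e
  rw [e]
  exact (summable_norm_sum_mul_antidiagonal_of_summable_norm hf' hg').of_norm.hasSum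

lemma hasSum_artanh_sq {x : ℝ} (hx : x ∈ Set.Ioo (0:ℝ) 1) :
    HasSum (fun k : ℕ => ratio k * x ^ (2 * k + 2)) (artanh x ^ 2) := by
  have p := hx.1
  have := hasSum_cauchyProduct (hasSum_artanh hx) (hasSum_artanh hx)
    (fun n => by positivity) (fun n => by positivity)
  refine hasSum_of_eq this (fun n => ?_) (sq _)
  rw [← sum_antidiagonal_inv_mul_inv, Finset.sum_mul]
  refine Finset.sum_congr rfl fun p hp => ?_
  rw [← Finset.HasAntidiagonal.mem_antidiagonal.1 hp]
  ring

lemma hasSum_artanh_cube {x : ℝ} (hx : x ∈ Set.Ioo (0:ℝ) 1) :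
    HasSum (fun j : ℕ => 3 * ratioSum j / (2 * (j : ℝ) + 1) * x ^ (2 * j + 1)) (artanh x ^ 3) := by
  have p := hx.1
  have := hasSum_cauchyProduct (hasSum_artanh_sq hx) (hasSum_artanh hx)
    (fun n => mul_nonneg (ratio_nonneg _) (by positivity)) (fun n => by positivity)
  rw [← hasSum_nat_add_iff' 1]
  refine hasSum_of_eq this (fun n => ?_) ?_
  · have e := sum_antidiagonal_ratio_div n
    have : 3 * ratioSum (n + 1) / (2 * ((n + 1 : ℕ) : ℝ) + 1) = 3 * ratioSum (n + 1) / (2 * (n : ℝ) + 3) := by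
      push_cast; ring
    rw [this, ← e, Finset.sum_mul]
    refine Finset.sum_congr rfl fun p hp => ?_
    rw [← Finset.HasAntidiagonal.mem_antidiagonal.1 hp]
    ring
  · simp [ratioSum]; ring

lemma hasSum_telescope {q : ℕ → ℝ} (hq : Filter.Tendsto q Filter.atTop (nhds 0)) (N : ℕ)
    (hmono : ∀ n, N ≤ n → q (n + 1) ≤ q n) : HasSum (fun n => q n - q (n + 1)) (q 0) := by
  rw [← hasSum_nat_add_iff' N, Finset.sum_range_sub', sub_sub_cancel,
    hasSum_iff_tendsto_nat_of_nonneg (fun i => sub_nonneg.2 (hmono _ (by omega)))]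
  have e : (fun n => ∑ i ∈ Finset.range n, (q (i + N) - q (i + N + 1))) = fun n => q N - q (n + N) := by
    ext n
    have := Finset.sum_range_sub' (fun i => q (i + N)) n
    simp only [zero_add] at this
    rw [← this]
    exact Finset.sum_congr rfl fun i _ => by rw [add_right_comm]
  rw [e]
  simpa using ((hq.comp (Filter.tendsto_add_atTop_nat N)).const_sub (q N))

lemma hasSum_telescope_shift {q : ℕ → ℝ} (hq : Filter.Tendsto q Filter.atTop (nhds 0)) (N : ℕ)
    (hmono : ∀ n, N ≤ n → q (n + 1) ≤ q n) (b : ℕ) :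
    HasSum (fun n => q n - q (n + b)) (∑ i ∈ Finset.range b, q i) := by
  have := hasSum_sum (s := Finset.range b) (f := fun i n => q (n + i) - q (n + i + 1)) (a := q)
    fun i _ => by
      have := hasSum_telescope (q := fun n => q (n + i)) (hq.comp (Filter.tendsto_add_atTop_nat i)) N
        fun n hn => by simpa [add_right_comm] using hmono (n + i) (by omega)
      refine hasSum_of_eq this (fun n => by simp [add_right_comm]) (by simp)
  refine hasSum_of_eq this (fun n => ?_) rfl
  exact (Finset.sum_range_sub' (fun i => q (n + i)) b).symm

lemma tendsto_one_div_two_mul_add_one :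
    Filter.Tendsto (fun j : ℕ => 1 / (2 * (j : ℝ) + 1)) Filter.atTop (nhds 0) := by
  refine squeeze_zero (fun j => by positivity) (fun j => ?_) tendsto_one_div_add_atTop_nhds_zero_nat
  apply one_div_le_one_div_of_le (by positivity); linarith [(Nat.cast_nonneg j : (0:ℝ) ≤ j)]

lemma hasSum_inv_mul_inv_shift (k : ℕ) :
    HasSum (fun j : ℕ => 1 / (2 * (j : ℝ) + 1) * (1 / (2 * (j : ℝ) + 2 * k + 3))) (ratio k / 2) := by
  have := (hasSum_telescope_shift (q := fun j : ℕ => 1 / (2 * (j : ℝ) + 1))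
    tendsto_one_div_two_mul_add_one 0 (fun n _ => by
      apply one_div_le_one_div_of_le (by positivity); push_cast; linarith) (k + 1)).mul_left
      (1 / (2 * (k : ℝ) + 2))
  refine hasSum_of_eq this (fun j => ?_) ?_
  · push_cast; field_simp; ring
  · change _ = _ * h (k + 1)
    rw [ratio]; field_simp

open MeasureTheory in
lemma lintegral_ofReal_hasSum {α ι : Type*} [MeasurableSpace α] {μ : Measure α} [Countable ι]
    {φ : ι → α → ℝ} {F : α → ℝ} {s : Set α} (hs : MeasurableSet s) (hφ : ∀ i, Measurable (φ i))
    (h0 : ∀ i, ∀ x ∈ s, 0 ≤ φ i x) (hF : ∀ x ∈ s, HasSum (fun i => φ i x) (F x)) :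
    ∫⁻ x in s, ENNReal.ofReal (F x) ∂μ = ∑' i, ∫⁻ x in s, ENNReal.ofReal (φ i x) ∂μ := by
  rw [← lintegral_tsum fun i => (hφ i).ennreal_ofReal.aemeasurable]
  refine setLIntegral_congr_fun hs fun x hx => ?_
  rw [← (hF x hx).tsum_eq, ENNReal.ofReal_tsum_of_nonneg (fun i => h0 i x hx) (hF x hx).summable]

open MeasureTheory in
lemma lintegral_pow_Ioo (n : ℕ) :
    ∫⁻ x in Set.Ioo (0:ℝ) 1, ENNReal.ofReal (x ^ n) = ENNReal.ofReal (1 / ((n : ℝ) + 1)) := by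
  have : IntegrableOn (fun x : ℝ => x ^ n) (Set.Ioo 0 1) :=
    (Continuous.integrableOn_Icc (by fun_prop)).mono_set Set.Ioo_subset_Icc_self
  rw [← ofReal_integral_eq_lintegral_ofReal this
    (ae_restrict_of_forall_mem measurableSet_Ioo fun x hx => pow_nonneg hx.1.le _),
    ← integral_Ioc_eq_integral_Ioo, ← intervalIntegral.integral_of_le zero_le_one]
  simp

lemma hasSum_of_tsum_ofReal {ι : Type*} {f : ι → ℝ} {c : ℝ} (hf : ∀ i, 0 ≤ f i) (hc : 0 ≤ c)
    (e : ∑' i, ENNReal.ofReal (f i) = ENNReal.ofReal c) : HasSum f c := by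
  have := ENNReal.hasSum_toReal (f := fun i => ENNReal.ofReal (f i)) (by rw [e]; exact ENNReal.ofReal_ne_top)
  rw [← ENNReal.tsum_toReal_eq (fun _ => ENNReal.ofReal_ne_top), e] at this
  simpa [hf, hc] using this

lemma tsum_ofReal_of_hasSum {ι : Type*} {f : ι → ℝ} {c : ℝ} (hf : ∀ i, 0 ≤ f i) (hs : HasSum f c) :
    ∑' i, ENNReal.ofReal (f i) = ENNReal.ofReal c := by
  rw [← hs.tsum_eq, ENNReal.ofReal_tsum_of_nonneg hf hs.summable]

@[fun_prop]
lemma measurable_artanh : Measurable artanh := by unfold artanh; fun_prop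

open MeasureTheory in
lemma lintegral_pow_mul_artanh (k : ℕ) :
    ∫⁻ x in Set.Ioo (0:ℝ) 1, ENNReal.ofReal (x ^ (2 * k + 1) * artanh x)
      = ENNReal.ofReal (ratio k / 2) := by
  rw [lintegral_ofReal_hasSum measurableSet_Ioo
    (φ := fun (j : ℕ) x => 1 / (2 * (j : ℝ) + 1) * x ^ (2 * j + 2 * k + 2))
    (fun i => by fun_prop) (fun i x hx => by have := hx.1; positivity)
    (fun x hx => hasSum_of_eq ((hasSum_artanh hx).mul_left (x ^ (2 * k + 1))) (fun j => by ring) rfl)]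
  rw [← tsum_ofReal_of_hasSum (fun j => by positivity) (hasSum_inv_mul_inv_shift k)]
  refine tsum_congr fun j => ?_
  simp_rw [ENNReal.ofReal_mul (show 0 ≤ 1 / (2 * (j : ℝ) + 1) by positivity)]
  rw [lintegral_const_mul _ (by fun_prop), lintegral_pow_Ioo]
  push_cast
  congr 3; ring

lemma hasDerivAt_tanh' (u : ℝ) : HasDerivAt tanh (1 / cosh u ^ 2) u := by
  have := (hasDerivAt_sinh u).div (hasDerivAt_cosh u) (cosh_pos u).ne'
  have e : tanh = sinh / cosh := by ext x; simp [tanh_eq_sinh_div_cosh]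
  rw [e]
  have e' : (1:ℝ) = cosh u * cosh u - sinh u * sinh u := by linarith [cosh_sq u]
  rw [e']; exact this

lemma tanh_pos' {u : ℝ} (hu : 0 < u) : 0 < tanh u := by
  rw [tanh_eq_sinh_div_cosh]; exact div_pos (sinh_pos_iff.2 hu) (cosh_pos u)

lemma image_tanh_Ioi : tanh '' Set.Ioi 0 = Set.Ioo 0 1 := by
  ext x
  constructor
  · rintro ⟨u, hu, rfl⟩; exact ⟨tanh_pos' hu, tanh_lt_one u⟩
  · rintro ⟨h0, h1⟩
    exact ⟨artanh x, artanh_pos ⟨h0, h1⟩, tanh_artanh ⟨by linarith, h1⟩⟩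

open MeasureTheory in
lemma lintegral_tanh_substitution (g : ℝ → ENNReal) :
    ∫⁻ x in Set.Ioo (0:ℝ) 1, g x
      = ∫⁻ u in Set.Ioi (0:ℝ), ENNReal.ofReal (1 / cosh u ^ 2) * g (tanh u) := by
  rw [← image_tanh_Ioi, lintegral_image_eq_lintegral_abs_deriv_mul measurableSet_Ioi
    (fun x _ => (hasDerivAt_tanh' x).hasDerivWithinAt) tanh_injective.injOn]
  refine lintegral_congr fun u => ?_
  rw [abs_of_nonneg (by positivity)]

open MeasureTheory in
lemma lintegral_pow_mul_exp_neg (s : ℕ) {c : ℝ} (hc : 0 < c) :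
    ∫⁻ u in Set.Ioi (0:ℝ), ENNReal.ofReal (u ^ s * exp (-(c * u)))
      = ENNReal.ofReal (s.factorial / c ^ (s + 1)) := by
  have key := integral_rpow_mul_exp_neg_mul_Ioi (a := s + 1) (by positivity) hc
  simp only [add_sub_cancel_right, rpow_natCast] at key
  have e : (1 / c) ^ ((s : ℝ) + 1) * Gamma (s + 1) = s.factorial / c ^ (s + 1) := by
    rw [Gamma_nat_eq_factorial]
    have : (1 / c) ^ ((s : ℝ) + 1) = (1 / c) ^ (s + 1) := by exact_mod_cast rpow_natCast (1 / c) (s + 1)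
    rw [this, one_div, inv_pow]; ring
  rw [e] at key
  have h_int : IntegrableOn (fun x ↦ x ^ s * rexp (-(c * x))) (Set.Ioi 0) :=
    .of_integral_ne_zero (by rw [key]; positivity)
  rw [← key, ofReal_integral_eq_lintegral_ofReal h_int
    (ae_restrict_of_forall_mem measurableSet_Ioi fun x hx => by have : 0 < x := hx; positivity)]

lemma hasSum_inv_sinh {u : ℝ} (hu : 0 < u) :
    HasSum (fun j : ℕ => 2 * exp (-((2 * (2 * (j : ℝ) + 1)) * u))) (1 / sinh (2 * u)) := by
  have lt : exp (-(4 * u)) < 1 := by rw [exp_lt_one_iff]; linarith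
  have := (hasSum_geometric_of_lt_one (exp_pos _).le lt).mul_left (2 * exp (-(2 * u)))
  refine hasSum_of_eq this (fun j => ?_) ?_
  · rw [← exp_nat_mul, mul_assoc 2 (exp _), ← exp_add]; ring_nf
  · rw [sinh_eq]
    have e4 : exp (-(4 * u)) = exp (-(2 * u)) ^ 2 := by rw [← exp_nat_mul]; ring_nf
    have e2 : exp (2 * u) * exp (-(2 * u)) = 1 := by rw [← exp_add]; simp
    rw [e4] at lt ⊢
    have p := exp_pos (-(2 * u))
    have q := exp_pos (2 * u)
    have l1 : exp (-(2 * u)) < exp (2 * u) := by rw [exp_lt_exp]; linarith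
    rw [← div_eq_mul_inv, div_eq_div_iff (by linarith) (by linarith)]
    linear_combination -e2

/-- The integral of `artanh x ^ s / x` over `(0, 1)`. -/
noncomputable def artanhIntegral (s : ℕ) : ENNReal :=
  ∫⁻ x in Set.Ioo (0:ℝ) 1, ENNReal.ofReal (artanh x ^ s / x)

open MeasureTheory in
lemma artanhIntegral_eq_lintegral_sinh (s : ℕ) :
    artanhIntegral s = ∫⁻ u in Set.Ioi (0:ℝ), ENNReal.ofReal (2 * (u ^ s * (1 / sinh (2 * u)))) := by
  rw [artanhIntegral, lintegral_tanh_substitution]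
  refine setLIntegral_congr_fun measurableSet_Ioi fun u hu => ?_
  have p := sinh_pos_iff.2 hu
  have q := cosh_pos u
  rw [← ENNReal.ofReal_mul (by positivity), artanh_tanh, tanh_eq_sinh_div_cosh, sinh_two_mul]
  congr 1
  field_simp

open MeasureTheory in
lemma artanhIntegral_eq_tsum (s : ℕ) :
    artanhIntegral s = ∑' j : ℕ, ENNReal.ofReal
      (4 * s.factorial / 2 ^ (s + 1) * (1 / (2 * (j : ℝ) + 1) ^ (s + 1))) := by
  rw [artanhIntegral_eq_lintegral_sinh, lintegral_ofReal_hasSum measurableSet_Ioi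
    (φ := fun (j : ℕ) u => 4 * (u ^ s * exp (-((2 * (2 * (j : ℝ) + 1)) * u))))
    (fun j => by fun_prop) (fun j u hu => by have : 0 < u := hu; positivity)
    (fun u hu => hasSum_of_eq ((hasSum_inv_sinh hu).mul_left (2 * u ^ s)) (fun j => by ring) (by ring))]
  refine tsum_congr fun j => ?_
  simp_rw [ENNReal.ofReal_mul (show (0:ℝ) ≤ 4 by norm_num)]
  rw [lintegral_const_mul _ (by fun_prop), lintegral_pow_mul_exp_neg s (by positivity),
    ← ENNReal.ofReal_mul (by norm_num)]
  congr 1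
  rw [mul_pow]; field_simp

/-- The sum of the reciprocals of the `s`-th powers of the odd positive integers. -/
noncomputable def oddZeta (s : ℕ) : ℝ := ∑' j : ℕ, 1 / (2 * (j : ℝ) + 1) ^ s

lemma summable_zeta_shift {s : ℕ} (hs : 2 ≤ s) : Summable fun n : ℕ => (1 : ℝ) / ((n : ℝ) + 1) ^ s := by
  have := (summable_nat_add_iff 1).2 (Real.summable_one_div_nat_pow.2 (show 1 < s by omega))
  simpa using this

lemma summable_oddZeta {s : ℕ} (hs : 2 ≤ s) : Summable fun j : ℕ => 1 / (2 * (j : ℝ) + 1) ^ s := by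
  refine (summable_zeta_shift hs).of_nonneg_of_le (fun _ => by positivity) fun j => ?_
  have : (0:ℝ) ≤ j := j.cast_nonneg
  gcongr; linarith

lemma oddZeta_eq {s : ℕ} (hs : 2 ≤ s) : oddZeta s = (1 - 1 / 2 ^ s) * zeta s := by
  have hz := (summable_zeta_shift hs).hasSum
  have h1 : HasSum (fun k : ℕ => (1 : ℝ) / (((2 * k : ℕ) : ℝ) + 1) ^ s) (oddZeta s) :=
    hasSum_of_eq (summable_oddZeta hs).hasSum (fun k => by push_cast; rfl) rfl
  have h2 : HasSum (fun k : ℕ => (1 : ℝ) / (((2 * k + 1 : ℕ) : ℝ) + 1) ^ s) (1 / 2 ^ s * zeta s) :=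
    hasSum_of_eq (hz.mul_left (1 / 2 ^ s)) (fun k => by
      push_cast
      rw [show (2 * (k:ℝ) + 1 + 1) = 2 * (k + 1) by ring, mul_pow]; field_simp) rfl
  have e : oddZeta s + 1 / 2 ^ s * zeta s = zeta s :=
    (HasSum.even_add_odd (f := fun n : ℕ => (1:ℝ) / ((n:ℝ) + 1) ^ s) h1 h2).unique hz
  linarith

lemma zeta_eq_of_hasSum {s : ℕ} (hs : s ≠ 0) {c : ℝ} (hc : HasSum (fun n : ℕ => 1 / (n : ℝ) ^ s) c) :
    zeta s = c := by
  have := (hasSum_nat_add_iff' 1).2 hc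
  refine HasSum.tsum_eq (hasSum_of_eq this (fun n => by push_cast; rfl) (by simp [hs]))

lemma zeta_two : zeta 2 = π ^ 2 / 6 := zeta_eq_of_hasSum (by norm_num) hasSum_zeta_two

lemma zeta_four : zeta 4 = π ^ 4 / 90 := zeta_eq_of_hasSum (by norm_num) hasSum_zeta_four

lemma bernoulli'_five' : bernoulli' 5 = 0 := bernoulli'_eq_zero_of_odd (by decide) (by norm_num)

lemma bernoulli'_six' : bernoulli' 6 = 1 / 42 := by
  have c2 : Nat.choose 6 2 = 15 := by decide
  have c4 : Nat.choose 6 4 = 15 := by decide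
  rw [bernoulli'_def]
  norm_num [Finset.sum_range_succ, Finset.sum_range_zero, c2, c4, bernoulli'_five']

lemma zeta_six : zeta 6 = π ^ 6 / 945 := by
  refine zeta_eq_of_hasSum (by norm_num) ?_
  have := hasSum_zeta_nat (k := 3) (by norm_num)
  refine hasSum_of_eq this (fun n => by norm_num) ?_
  rw [bernoulli_eq_bernoulli'_of_ne_one (by norm_num)]
  norm_num [bernoulli'_six', Nat.factorial]
  ring

lemma oddZeta_two : oddZeta 2 = π ^ 2 / 8 := by rw [oddZeta_eq le_rfl, zeta_two]; ring

lemma oddZeta_four : oddZeta 4 = π ^ 4 / 96 := by rw [oddZeta_eq (by norm_num), zeta_four]; ring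

lemma oddZeta_six : oddZeta 6 = π ^ 6 / 960 := by rw [oddZeta_eq (by norm_num), zeta_six]; ring

lemma artanhIntegral_eq {s : ℕ} (hs : 1 ≤ s) : artanhIntegral s
    = ENNReal.ofReal (4 * s.factorial / 2 ^ (s + 1) * oddZeta (s + 1)) := by
  rw [artanhIntegral_eq_tsum]
  exact tsum_ofReal_of_hasSum (fun _ => by positivity)
    ((summable_oddZeta (by omega)).hasSum.mul_left _)

lemma artanhIntegral_three : artanhIntegral 3 = ENNReal.ofReal (π ^ 4 / 64) := by
  rw [artanhIntegral_eq (by norm_num), oddZeta_four]; congr 1; norm_num [Nat.factorial]; ring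

lemma artanhIntegral_five : artanhIntegral 5 = ENNReal.ofReal (π ^ 6 / 128) := by
  rw [artanhIntegral_eq (by norm_num), oddZeta_six]; congr 1; norm_num [Nat.factorial]; ring

lemma artanhIntegral_two : artanhIntegral 2 = ENNReal.ofReal (7 / 8 * zeta 3) := by
  rw [artanhIntegral_eq (by norm_num), oddZeta_eq (by norm_num)]; norm_num [Nat.factorial]

open MeasureTheory in
lemma artanhIntegral_three_eq_tsum_sq :
    artanhIntegral 3 = ∑' k, ENNReal.ofReal (ratio k ^ 2 / 2) := by
  rw [artanhIntegral, lintegral_ofReal_hasSum measurableSet_Ioo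
    (φ := fun (k : ℕ) x => ratio k * (x ^ (2 * k + 1) * artanh x))
    (fun i => by fun_prop) (fun i x hx => mul_nonneg (ratio_nonneg _)
      (mul_nonneg (pow_nonneg hx.1.le _) (artanh_nonneg hx.1.le)))
    (fun x hx => hasSum_of_eq ((hasSum_artanh_sq hx).mul_left (artanh x / x))
      (fun j => by have := hx.1; field_simp; ring) (by ring))]
  refine tsum_congr fun j => ?_
  simp_rw [ENNReal.ofReal_mul (ratio_nonneg j)]
  rw [lintegral_const_mul _ (by fun_prop), lintegral_pow_mul_artanh,
    ← ENNReal.ofReal_mul (ratio_nonneg j)]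
  congr 1; ring

open MeasureTheory in
lemma artanhIntegral_three_eq_tsum_ratioSum :
    artanhIntegral 3 = ∑' j, ENNReal.ofReal (3 * ratioSum j / (2 * (j : ℝ) + 1) ^ 2) := by
  have nn (j : ℕ) : 0 ≤ 3 * ratioSum j / (2 * (j : ℝ) + 1) :=
    div_nonneg (mul_nonneg (by norm_num) (ratioSum_nonneg j)) (by positivity)
  rw [artanhIntegral, lintegral_ofReal_hasSum measurableSet_Ioo
    (φ := fun (j : ℕ) x => 3 * ratioSum j / (2 * (j : ℝ) + 1) * x ^ (2 * j))
    (fun i => by fun_prop) (fun i x hx => mul_nonneg (nn i) (pow_nonneg hx.1.le _))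
    (fun x hx => hasSum_of_eq ((hasSum_artanh_cube hx).mul_left (1 / x))
      (fun j => by have := hx.1; field_simp; ring) (by ring))]
  refine tsum_congr fun j => ?_
  simp_rw [ENNReal.ofReal_mul (nn j)]
  rw [lintegral_const_mul _ (by fun_prop), lintegral_pow_Ioo, ← ENNReal.ofReal_mul (nn j)]
  congr 1; push_cast; field_simp

open MeasureTheory in
lemma lintegral_pow_mul_artanh_sq (j : ℕ) :
    ∫⁻ x in Set.Ioo (0:ℝ) 1, ENNReal.ofReal (x ^ (2 * j) * artanh x ^ 2)
      = ∑' k : ℕ, ENNReal.ofReal (ratio k / (2 * (k : ℝ) + 2 * j + 3)) := by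
  rw [lintegral_ofReal_hasSum measurableSet_Ioo
    (φ := fun (k : ℕ) x => ratio k * x ^ (2 * k + 2 + 2 * j))
    (fun i => by fun_prop) (fun i x hx => mul_nonneg (ratio_nonneg _) (pow_nonneg hx.1.le _))
    (fun x hx => hasSum_of_eq ((hasSum_artanh_sq hx).mul_left (x ^ (2 * j)))
      (fun k => by ring) rfl)]
  refine tsum_congr fun k => ?_
  simp_rw [ENNReal.ofReal_mul (ratio_nonneg k)]
  rw [lintegral_const_mul _ (by fun_prop), lintegral_pow_Ioo, ← ENNReal.ofReal_mul (ratio_nonneg k)]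
  congr 1; push_cast; field_simp; ring

open MeasureTheory in
lemma lintegral_pow_mul_artanh_cube (k : ℕ) :
    ∫⁻ x in Set.Ioo (0:ℝ) 1, ENNReal.ofReal (x ^ (2 * k + 1) * artanh x ^ 3)
      = ∑' m : ℕ, ENNReal.ofReal (ratio m * ratio (k + m + 1) / 2) := by
  rw [lintegral_ofReal_hasSum measurableSet_Ioo
    (φ := fun (m : ℕ) x => ratio m * (x ^ (2 * (k + m + 1) + 1) * artanh x))
    (fun i => by fun_prop) (fun i x hx => mul_nonneg (ratio_nonneg _)
      (mul_nonneg (pow_nonneg hx.1.le _) (artanh_nonneg hx.1.le)))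
    (fun x hx => hasSum_of_eq ((hasSum_artanh_sq hx).mul_left (x ^ (2 * k + 1) * artanh x))
      (fun k => by ring) (by ring))]
  refine tsum_congr fun m => ?_
  simp_rw [ENNReal.ofReal_mul (ratio_nonneg m)]
  rw [lintegral_const_mul _ (by fun_prop), lintegral_pow_mul_artanh,
    ← ENNReal.ofReal_mul (ratio_nonneg m)]
  congr 1; ring

open MeasureTheory in
lemma artanhIntegral_five_eq_tsum_ratio :
    artanhIntegral 5 = ∑' k, ∑' m, ENNReal.ofReal (ratio k * ratio m * ratio (k + m + 1) / 2) := by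
  rw [artanhIntegral, lintegral_ofReal_hasSum measurableSet_Ioo
    (φ := fun (k : ℕ) x => ratio k * (x ^ (2 * k + 1) * artanh x ^ 3))
    (fun i => by fun_prop) (fun i x hx => mul_nonneg (ratio_nonneg _)
      (mul_nonneg (pow_nonneg hx.1.le _) (pow_nonneg (artanh_nonneg hx.1.le) _)))
    (fun x hx => hasSum_of_eq ((hasSum_artanh_sq hx).mul_left (artanh x ^ 3 / x))
      (fun j => by have := hx.1; field_simp; ring) (by ring))]
  refine tsum_congr fun k => ?_
  simp_rw [ENNReal.ofReal_mul (ratio_nonneg k)]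
  rw [lintegral_const_mul _ (by fun_prop), lintegral_pow_mul_artanh_cube, ← ENNReal.tsum_mul_left]
  refine tsum_congr fun m => ?_
  rw [← ENNReal.ofReal_mul (ratio_nonneg k)]
  congr 1; ring

open MeasureTheory in
lemma artanhIntegral_five_eq_tsum_ratioSum :
    artanhIntegral 5 = ∑' j : ℕ, ENNReal.ofReal (3 * ratioSum j / (2 * (j : ℝ) + 1)) *
      ∑' k : ℕ, ENNReal.ofReal (ratio k / (2 * (k : ℝ) + 2 * j + 3)) := by
  have nn (j : ℕ) : 0 ≤ 3 * ratioSum j / (2 * (j : ℝ) + 1) :=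
    div_nonneg (mul_nonneg (by norm_num) (ratioSum_nonneg j)) (by positivity)
  rw [artanhIntegral, lintegral_ofReal_hasSum measurableSet_Ioo
    (φ := fun (j : ℕ) x => 3 * ratioSum j / (2 * (j : ℝ) + 1) * (x ^ (2 * j) * artanh x ^ 2))
    (fun i => by fun_prop) (fun i x hx => mul_nonneg (nn i)
      (mul_nonneg (pow_nonneg hx.1.le _) (by positivity)))
    (fun x hx => hasSum_of_eq ((hasSum_artanh_cube hx).mul_left (artanh x ^ 2 / x))
      (fun j => by have := hx.1; field_simp; ring) (by ring))]
  refine tsum_congr fun j => ?_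
  simp_rw [ENNReal.ofReal_mul (nn j)]
  rw [lintegral_const_mul _ (by fun_prop), lintegral_pow_mul_artanh_sq]

lemma hasSum_ratio_sq : HasSum (fun k => ratio k ^ 2) (π ^ 4 / 32) := by
  have := hasSum_of_tsum_ofReal (fun k => by positivity) (by positivity)
    (artanhIntegral_three_eq_tsum_sq.symm.trans artanhIntegral_three)
  exact hasSum_of_eq (this.mul_left 2) (fun k => by ring) (by ring)

lemma hasSum_ratioSum_div_sq :
    HasSum (fun j : ℕ => ratioSum j / (2 * (j : ℝ) + 1) ^ 2) (π ^ 4 / 192) := by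
  have := hasSum_of_tsum_ofReal
    (fun j => div_nonneg (mul_nonneg (by norm_num) (ratioSum_nonneg j)) (by positivity)) (by positivity)
    (artanhIntegral_three_eq_tsum_ratioSum.symm.trans artanhIntegral_three)
  exact hasSum_of_eq (this.mul_left (1 / 3)) (fun k => by ring) (by ring)

lemma tendsto_ratio : Filter.Tendsto ratio Filter.atTop (nhds 0) := by
  have := hasSum_ratio_sq.summable.tendsto_atTop_zero.sqrt
  simpa [Real.sqrt_sq (ratio_nonneg _)] using this

/-- The moments `∑ a_k / (2 k + b)` of the ratios `a_k = h_k / k`, where `b = 2 j + 1`. -/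
noncomputable def ratioMoment (j : ℕ) : ℝ := ∑' k : ℕ, ratio k / (2 * (k : ℝ) + 2 * j + 3)

lemma summable_ratioMoment (j : ℕ) :
    Summable fun k : ℕ => ratio k / (2 * (k : ℝ) + 2 * j + 3) := by
  refine (hasSum_ratio_sq.summable.add (summable_zeta_shift le_rfl)).of_nonneg_of_le
    (fun k => div_nonneg (ratio_nonneg k) (by positivity)) fun k => ?_
  have h1 : ratio k / (2 * (k : ℝ) + 2 * j + 3) ≤ ratio k * (1 / ((k : ℝ) + 1)) := by
    rw [div_eq_mul_one_div]
    refine mul_le_mul_of_nonneg_left (one_div_le_one_div_of_le (by positivity) ?_) (ratio_nonneg k)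
    linarith [(Nat.cast_nonneg k : (0:ℝ) ≤ k), (Nat.cast_nonneg j : (0:ℝ) ≤ j)]
  rw [show (1:ℝ) / ((k : ℝ) + 1) ^ 2 = (1 / ((k : ℝ) + 1)) ^ 2 by rw [one_div_pow]]
  nlinarith [sq_nonneg (ratio k - 1 / ((k : ℝ) + 1)), sq_nonneg (ratio k), sq_nonneg (1 / ((k : ℝ) + 1))]

lemma ratioMoment_nonneg (j : ℕ) : 0 ≤ ratioMoment j :=
  tsum_nonneg fun k => div_nonneg (ratio_nonneg k) (by positivity)

lemma tsum_ofReal_ratio_div (j : ℕ) :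
    ∑' k : ℕ, ENNReal.ofReal (ratio k / (2 * (k : ℝ) + 2 * j + 3))
      = ENNReal.ofReal (ratioMoment j) :=
  tsum_ofReal_of_hasSum (fun k => div_nonneg (ratio_nonneg k) (by positivity))
    (summable_ratioMoment j).hasSum

lemma hasSum_h_mul_sub (j : ℕ) :
    HasSum (fun k : ℕ => 2 * h (k + 1) * (1 / (2 * (k : ℝ) + 2 * j + 3) - 1 / (2 * (k : ℝ) + 2 * j + 5)))
      (ratio j) := by
  have t0 : Filter.Tendsto (fun k : ℕ => 2 * h (k + 1) / (2 * (k : ℝ) + 2 * j + 3)) Filter.atTop (nhds 0) := by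
    refine squeeze_zero (fun k => div_nonneg (mul_nonneg zero_le_two (h_nonneg _)) (by positivity))
      (fun k => ?_) tendsto_ratio
    rw [ratio, div_le_div_iff₀ (by positivity) (by positivity)]
    nlinarith [h_nonneg (k + 1), mul_nonneg (h_nonneg (k + 1)) (Nat.cast_nonneg j : (0:ℝ) ≤ j)]
  have t1 := hasSum_telescope t0 j fun k hk => by
    rw [div_le_div_iff₀ (by positivity) (by positivity), h_succ (k + 1)]
    have hk' : (j:ℝ) ≤ k := by exact_mod_cast hk
    have := one_le_h_succ k
    have e : 1 / (2 * (k:ℝ) + 3) * (2 * k + 2 * j + 3) ≤ 2 := by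
      rw [one_div_mul_eq_div, div_le_iff₀ (by positivity)]; linarith
    push_cast
    rw [show 2 * ((k:ℝ) + 1) + 1 = 2 * k + 3 by ring]
    nlinarith
  have t2 := (hasSum_nat_add_iff' 1).2 ((hasSum_inv_mul_inv_shift j).mul_left 2)
  refine hasSum_of_eq (t1.add t2) (fun k => ?_) ?_
  · rw [h_succ (k + 1)]; push_cast; field_simp; ring
  · simp [h]; field_simp; ring

lemma ratioMoment_succ (j : ℕ) :
    (2 * (j : ℝ) + 3) * ratioMoment (j + 1) = (2 * (j : ℝ) + 1) * ratioMoment j + ratio j := by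
  have e := (((summable_ratioMoment (j + 1)).hasSum.mul_left (2 * (j : ℝ) + 3)).sub
    ((summable_ratioMoment j).hasSum.mul_left (2 * (j : ℝ) + 1))).unique
    (hasSum_of_eq (hasSum_h_mul_sub j) (fun k => by rw [ratio]; push_cast; field_simp; ring) rfl)
  change _ * ratioMoment (j + 1) - _ * ratioMoment j = _ at e
  linarith

lemma mul_ratioMoment (j : ℕ) :
    (2 * (j : ℝ) + 1) * ratioMoment j = ratioSum j + ratioMoment 0 := by
  induction j with
  | zero => simp [ratioSum]
  | succ j ih =>
    rw [ratioSum_succ]; push_cast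
    linear_combination ratioMoment_succ j + ih

open MeasureTheory in
lemma artanhIntegral_three_eq_tsum_ratioMoment :
    artanhIntegral 3 = ∑' j : ℕ, ENNReal.ofReal (1 / (2 * (j : ℝ) + 1) * ratioMoment j) := by
  have nn (j : ℕ) : 0 ≤ 1 / (2 * (j : ℝ) + 1) := by positivity
  rw [artanhIntegral, lintegral_ofReal_hasSum measurableSet_Ioo
    (φ := fun (j : ℕ) x => 1 / (2 * (j : ℝ) + 1) * (x ^ (2 * j) * artanh x ^ 2))
    (fun i => by fun_prop) (fun i x hx => mul_nonneg (nn i)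
      (mul_nonneg (pow_nonneg hx.1.le _) (by positivity)))
    (fun x hx => hasSum_of_eq ((hasSum_artanh hx).mul_left (artanh x ^ 2 / x))
      (fun j => by have := hx.1; field_simp; ring) (by ring))]
  refine tsum_congr fun j => ?_
  simp_rw [ENNReal.ofReal_mul (nn j)]
  rw [lintegral_const_mul _ (by fun_prop), lintegral_pow_mul_artanh_sq, tsum_ofReal_ratio_div]

lemma ratioMoment_eq (j : ℕ) :
    ratioMoment j = (ratioSum j + ratioMoment 0) / (2 * (j : ℝ) + 1) := by
  rw [← mul_ratioMoment]; field_simp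

lemma ratioMoment_zero : ratioMoment 0 = π ^ 2 / 12 := by
  have h1 := hasSum_of_tsum_ofReal
    (fun j => mul_nonneg (by positivity) (ratioMoment_nonneg j)) (by positivity)
    (artanhIntegral_three_eq_tsum_ratioMoment.symm.trans artanhIntegral_three)
  have h2 := hasSum_ratioSum_div_sq.add ((summable_oddZeta le_rfl).hasSum.mul_left (ratioMoment 0))
  have e := h1.unique (hasSum_of_eq h2 (fun j => by rw [ratioMoment_eq]; field_simp) rfl)
  change _ = _ + _ * oddZeta 2 at e
  rw [oddZeta_two] at e
  have p := pi_pos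
  have : π ^ 2 * (ratioMoment 0 - π ^ 2 / 12) = 0 := by linarith
  rcases mul_eq_zero.1 this with h' | h'
  · exact absurd h' (by positivity)
  · linarith

lemma hasSum_ratioMoment_sq : HasSum (fun j => ratioMoment j ^ 2) (π ^ 6 / 256) := by
  have nn (j : ℕ) : 0 ≤ 3 * ratioSum j / (2 * (j : ℝ) + 1) :=
    div_nonneg (mul_nonneg (by norm_num) (ratioSum_nonneg j)) (by positivity)
  have e := artanhIntegral_five_eq_tsum_ratioSum.symm.trans artanhIntegral_five
  simp_rw [tsum_ofReal_ratio_div, ← ENNReal.ofReal_mul (nn _)] at e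
  have h1 := hasSum_of_tsum_ofReal
    (fun j => mul_nonneg (nn j) (ratioMoment_nonneg j)) (by positivity) e
  have h2 := hasSum_of_tsum_ofReal
    (fun j => mul_nonneg (by positivity) (ratioMoment_nonneg j)) (by positivity)
    (artanhIntegral_three_eq_tsum_ratioMoment.symm.trans artanhIntegral_three)
  refine hasSum_of_eq ((h1.mul_left (1 / 3)).add (h2.mul_left (ratioMoment 0))) (fun j => ?_) ?_
  · nth_rw 1 [sq, ratioMoment_eq]; field_simp
  · rw [ratioMoment_zero]; ring

lemma hasSum_ratio_triple :
    HasSum (fun p : ℕ × ℕ => ratio p.1 * ratio p.2 * ratio (p.1 + p.2 + 1)) (π ^ 6 / 64) := by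
  have e := artanhIntegral_five_eq_tsum_ratio.symm.trans artanhIntegral_five
  rw [← ENNReal.tsum_prod (f := fun k m => ENNReal.ofReal (ratio k * ratio m * ratio (k + m + 1) / 2))] at e
  have h1 := hasSum_of_tsum_ofReal (fun p : ℕ × ℕ => div_nonneg (mul_nonneg
    (mul_nonneg (ratio_nonneg p.1) (ratio_nonneg p.2)) (ratio_nonneg _)) zero_le_two) (by positivity) e
  exact hasSum_of_eq (h1.mul_left 2) (fun k => by ring) (by ring)

/-- Pairs of naturals are diagonal, strictly above the diagonal, or strictly below it. -/
noncomputable def pairSplit : ℕ ⊕ (ℕ × ℕ ⊕ ℕ × ℕ) ≃ ℕ × ℕ :=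
  Equiv.ofBijective (Sum.elim (fun k => (k, k))
    (Sum.elim (fun p => (p.1, p.1 + p.2 + 1)) (fun p => (p.1 + p.2 + 1, p.1)))) <| by
    constructor
    · rintro (a | ⟨a, b⟩ | ⟨a, b⟩) (c | ⟨c, d⟩ | ⟨c, d⟩) e <;>
        simp only [Sum.elim_inl, Sum.elim_inr, Prod.mk.injEq] at e <;> simp <;> omega
    · rintro ⟨a, b⟩
      rcases lt_trichotomy a b with l | rfl | l
      · exact ⟨Sum.inr (Sum.inl (a, b - a - 1)), by simp; omega⟩
      · exact ⟨Sum.inl a, rfl⟩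
      · exact ⟨Sum.inr (Sum.inr (b, a - b - 1)), by simp; omega⟩

lemma tsum_pair_split {f : ℕ × ℕ → ℝ} (hf : Summable f) :
    ∑' p, f p = ∑' k, f (k, k) +
      (∑' p : ℕ × ℕ, f (p.1, p.1 + p.2 + 1) + ∑' p : ℕ × ℕ, f (p.1 + p.2 + 1, p.1)) := by
  have s := (pairSplit.summable_iff (f := f)).2 hf
  have s2 := s.comp_injective Sum.inr_injective
  rw [← pairSplit.tsum_eq f]
  have e1 := Summable.tsum_sum (f := fun x => f (pairSplit x)) (s.comp_injective Sum.inl_injective) s2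
  have e2 := Summable.tsum_sum (f := fun x => f (pairSplit (Sum.inr x)))
    (s2.comp_injective Sum.inl_injective) (s2.comp_injective Sum.inr_injective)
  exact e1.trans (congrArg _ e2)

lemma summable_pair_diag {f : ℕ × ℕ → ℝ} (hf : Summable f) : Summable fun k => f (k, k) :=
  hf.comp_injective fun a b e => by simpa using e

lemma summable_of_pair_split {f : ℕ × ℕ → ℝ} (hd : Summable fun k => f (k, k))
    (ha : Summable fun p : ℕ × ℕ => f (p.1, p.1 + p.2 + 1))
    (hb : Summable fun p : ℕ × ℕ => f (p.1 + p.2 + 1, p.1)) : Summable f := by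
  rw [← pairSplit.summable_iff]
  exact Summable.sum _ hd (Summable.sum _ ha hb)

/-- The kernel `∑ 1 / ((2 k + b) (2 l + b))` over odd `b`, with `k` and `l` shifted by one. -/
noncomputable def oddKernel (k l : ℕ) : ℝ :=
  ∑' j : ℕ, 1 / (2 * (k : ℝ) + 2 * j + 3) * (1 / (2 * (l : ℝ) + 2 * j + 3))

lemma hasSum_oddKernel_self (k : ℕ) :
    HasSum (fun j : ℕ => 1 / (2 * (k : ℝ) + 2 * j + 3) * (1 / (2 * (k : ℝ) + 2 * j + 3)))
      (oddZeta 2 - h2 (k + 1)) :=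
  hasSum_of_eq ((hasSum_nat_add_iff' (k + 1)).2 (summable_oddZeta le_rfl).hasSum)
    (fun j => by push_cast; field_simp; ring) rfl

lemma hasSum_oddKernel_lt (k m : ℕ) :
    HasSum (fun j : ℕ => 1 / (2 * (k : ℝ) + 2 * j + 3) * (1 / (2 * ((k + m + 1 : ℕ) : ℝ) + 2 * j + 3)))
      ((h (k + m + 2) - h (k + 1)) / (2 * ((m : ℝ) + 1))) := by
  have := (hasSum_telescope_shift (q := fun j : ℕ => 1 / (2 * ((j + (k + 1) : ℕ) : ℝ) + 1))
    (tendsto_one_div_two_mul_add_one.comp (Filter.tendsto_add_atTop_nat (k + 1))) 0 (fun n _ => by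
      apply one_div_le_one_div_of_le (by positivity); push_cast; linarith) (m + 1)).mul_left
      (1 / (2 * ((m : ℝ) + 1)))
  refine hasSum_of_eq this (fun j => ?_) ?_
  · push_cast; field_simp; ring
  · rw [one_div_mul_eq_div]
    congr 1
    rw [show k + m + 2 = (k + 1) + (m + 1) by ring, h, h, Finset.sum_range_add]
    simp [add_comm]

lemma tsum_ofReal_mul_self {f : ℕ → ℝ} {c : ℝ} (hf : ∀ k, 0 ≤ f k) (hs : HasSum f c) :
    ∑' p : ℕ × ℕ, ENNReal.ofReal (f p.1 * f p.2) = ENNReal.ofReal (c ^ 2) := by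
  have s : Summable fun p : ℕ × ℕ => f p.1 * f p.2 := hs.summable.mul_of_nonneg hs.summable hf hf
  have m : HasSum (fun p : ℕ × ℕ => f p.1 * f p.2) (c * c) := hs.mul hs s
  rw [sq]
  exact tsum_ofReal_of_hasSum (fun p => mul_nonneg (hf p.1) (hf p.2)) m

lemma hasSum_oddKernel (k l : ℕ) : HasSum (fun j : ℕ =>
    1 / (2 * (k : ℝ) + 2 * j + 3) * (1 / (2 * (l : ℝ) + 2 * j + 3))) (oddKernel k l) := by
  refine Summable.hasSum ?_
  rcases lt_trichotomy k l with e | rfl | e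
  · obtain ⟨m, rfl⟩ := Nat.exists_eq_add_of_lt e
    exact (hasSum_oddKernel_lt k m).summable
  · exact (hasSum_oddKernel_self k).summable
  · obtain ⟨m, rfl⟩ := Nat.exists_eq_add_of_lt e
    exact (hasSum_of_eq (hasSum_oddKernel_lt l m) (fun j => mul_comm _ _) rfl).summable

lemma oddKernel_nonneg (k l : ℕ) : 0 ≤ oddKernel k l := tsum_nonneg fun _ => by positivity

lemma ofReal_ratioMoment_sq (j : ℕ) :
    ENNReal.ofReal (ratioMoment j ^ 2) = ∑' p : ℕ × ℕ, ENNReal.ofReal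
      (ratio p.1 / (2 * (p.1 : ℝ) + 2 * j + 3) * (ratio p.2 / (2 * (p.2 : ℝ) + 2 * j + 3))) :=
  (tsum_ofReal_mul_self (fun k => div_nonneg (ratio_nonneg k) (by positivity))
    (summable_ratioMoment j).hasSum).symm

lemma tsum_ofReal_ratio_mul_oddKernel (p : ℕ × ℕ) :
    ∑' j : ℕ, ENNReal.ofReal
      (ratio p.1 / (2 * (p.1 : ℝ) + 2 * j + 3) * (ratio p.2 / (2 * (p.2 : ℝ) + 2 * j + 3)))
      = ENNReal.ofReal (ratio p.1 * ratio p.2 * oddKernel p.1 p.2) := by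
  refine tsum_ofReal_of_hasSum (fun j => mul_nonneg (div_nonneg (ratio_nonneg _) (by positivity))
    (div_nonneg (ratio_nonneg _) (by positivity))) ?_
  exact hasSum_of_eq ((hasSum_oddKernel p.1 p.2).mul_left (ratio p.1 * ratio p.2))
    (fun j => by ring) rfl

lemma hasSum_ratio_mul_oddKernel :
    HasSum (fun p : ℕ × ℕ => ratio p.1 * ratio p.2 * oddKernel p.1 p.2) (π ^ 6 / 256) := by
  refine hasSum_of_tsum_ofReal (fun p => mul_nonneg (mul_nonneg (ratio_nonneg _) (ratio_nonneg _))
    (oddKernel_nonneg _ _)) (by positivity) ?_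
  rw [← tsum_ofReal_of_hasSum (fun _ => sq_nonneg _) hasSum_ratioMoment_sq]
  simp_rw [ofReal_ratioMoment_sq, ← tsum_ofReal_ratio_mul_oddKernel]
  exact ENNReal.tsum_comm

lemma oddKernel_comm (k l : ℕ) : oddKernel k l = oddKernel l k := tsum_congr fun _ => mul_comm _ _

/-- The double sum `∑ a_k a_{k+m} (h_{k+m} - h_k) / m`. -/
noncomputable def gapSum : ℝ :=
  ∑' p : ℕ × ℕ, ratio p.1 * ratio (p.1 + p.2 + 1) * (h (p.1 + p.2 + 2) - h (p.1 + 1)) / ((p.2 : ℝ) + 1)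

lemma h2_le (k : ℕ) : h2 k ≤ oddZeta 2 :=
  (summable_oddZeta le_rfl).sum_le_tsum _ fun _ _ => by positivity

lemma h2_nonneg (k : ℕ) : 0 ≤ h2 k := Finset.sum_nonneg fun _ _ => by positivity

lemma summable_h2_mul_ratio_sq : Summable fun k => h2 (k + 1) * ratio k ^ 2 :=
  (hasSum_ratio_sq.summable.mul_left (oddZeta 2)).of_nonneg_of_le
    (fun _ => mul_nonneg (h2_nonneg _) (sq_nonneg _))
    fun _ => mul_le_mul_of_nonneg_right (h2_le _) (sq_nonneg _)

lemma tsum_h2_mul_ratio_sq_eq_gapSum :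
    ∑' k, h2 (k + 1) * ratio k ^ 2 = gapSum := by
  have e := tsum_pair_split hasSum_ratio_mul_oddKernel.summable
  have d1 (k m : ℕ) : oddKernel k (k + m + 1) = (h (k + m + 2) - h (k + 1)) / (2 * ((m : ℝ) + 1)) :=
    (hasSum_oddKernel_lt k m).tsum_eq
  have d2 (k m : ℕ) : oddKernel (k + m + 1) k = (h (k + m + 2) - h (k + 1)) / (2 * ((m : ℝ) + 1)) := by
    rw [oddKernel_comm, d1]
  have d3 (k : ℕ) : oddKernel k k = oddZeta 2 - h2 (k + 1) := (hasSum_oddKernel_self k).tsum_eq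
  simp only [d1, d2, d3] at e
  have g1 : ∑' p : ℕ × ℕ, ratio p.1 * ratio (p.1 + p.2 + 1) *
      ((h (p.1 + p.2 + 2) - h (p.1 + 1)) / (2 * ((p.2 : ℝ) + 1))) = gapSum / 2 := by
    rw [gapSum, ← tsum_div_const]
    exact tsum_congr fun p => by field_simp
  have g2 : ∑' p : ℕ × ℕ, ratio (p.1 + p.2 + 1) * ratio p.1 *
      ((h (p.1 + p.2 + 2) - h (p.1 + 1)) / (2 * ((p.2 : ℝ) + 1))) = gapSum / 2 := by
    rw [← g1]
    exact tsum_congr fun p => by ring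
  have g3 : ∑' k, ratio k * ratio k * (oddZeta 2 - h2 (k + 1))
      = oddZeta 2 * (π ^ 4 / 32) - ∑' k, h2 (k + 1) * ratio k ^ 2 :=
    (hasSum_of_eq ((hasSum_ratio_sq.mul_left (oddZeta 2)).sub summable_h2_mul_ratio_sq.hasSum)
      (fun k => by ring) rfl).tsum_eq
  rw [g1, g2, g3, hasSum_ratio_mul_oddKernel.tsum_eq, oddZeta_two] at e
  linarith

lemma h_le_harmonic (n : ℕ) : h n ≤ (harmonic n : ℝ) := by
  rw [harmonic]
  push_cast
  refine Finset.sum_le_sum fun j _ => ?_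
  rw [← one_div]
  apply one_div_le_one_div_of_le (by positivity)
  linarith [(Nat.cast_nonneg j : (0:ℝ) ≤ j)]

lemma h_le_rpow {n : ℕ} (hn : 1 ≤ n) : h n ≤ 7 * (n : ℝ) ^ (1 / 6 : ℝ) := by
  have h1 := (h_le_harmonic n).trans (harmonic_le_one_add_log n)
  have h2 := Real.log_le_rpow_div (Nat.cast_nonneg n : (0:ℝ) ≤ n) (show (0:ℝ) < 1 / 6 by norm_num)
  have h3 : 1 ≤ (n : ℝ) ^ (1 / 6 : ℝ) := Real.one_le_rpow (by exact_mod_cast hn) (by norm_num)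
  linarith

lemma summable_h_cube_div : Summable fun p : ℕ × ℕ => h (p.1 + p.2 + 2) ^ 3 /
    (((p.1 : ℝ) + 1) * ((p.2 : ℝ) + 1) * ((p.1 : ℝ) + p.2 + 2)) := by
  have s : Summable fun k : ℕ => ((k : ℝ) + 1) ^ (-(5 / 4) : ℝ) := by
    have := (summable_nat_add_iff 1).2 (Real.summable_nat_rpow.2 (show (-(5 / 4) : ℝ) < -1 by norm_num))
    simpa using this
  refine ((s.mul_of_nonneg s (fun k => by positivity) (fun k => by positivity)).mul_left 343).of_nonneg_of_le
    (fun p => div_nonneg (pow_nonneg (h_nonneg _) _) (by positivity)) fun p => ?_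
  set x : ℝ := (p.1 : ℝ) + 1 with hx
  set y : ℝ := (p.2 : ℝ) + 1 with hy
  have px : 0 < x := by positivity
  have py : 0 < y := by positivity
  have e : (p.1 : ℝ) + p.2 + 2 = x + y := by rw [hx, hy]; ring
  have b := h_le_rpow (n := p.1 + p.2 + 2) (by omega)
  push_cast at b
  rw [e] at b ⊢
  have b3 : h (p.1 + p.2 + 2) ^ 3 ≤ 343 * (x + y) ^ (1 / 2 : ℝ) := by
    calc _ ≤ (7 * (x + y) ^ (1 / 6 : ℝ)) ^ 3 := pow_le_pow_left₀ (h_nonneg _) b 3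
      _ = _ := by rw [mul_pow, ← Real.rpow_mul_natCast (by positivity)]; norm_num
  have c : (x * y) ^ (1 / 4 : ℝ) ≤ (x + y) ^ (1 / 2 : ℝ) := by
    calc (x * y) ^ (1 / 4 : ℝ) ≤ ((x + y) ^ 2) ^ (1 / 4 : ℝ) :=
          Real.rpow_le_rpow (by positivity) (by nlinarith) (by norm_num)
      _ = _ := by rw [← Real.rpow_natCast_mul (by positivity)]; norm_num
  have d : (x + y) ^ (1 / 2 : ℝ) * (x + y) ^ (1 / 2 : ℝ) = x + y := by
    rw [← Real.rpow_add (by positivity)]; norm_num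
  have f (z : ℝ) (hz : 0 < z) : z ^ (-(5 / 4) : ℝ) * z ^ (1 / 4 : ℝ) = 1 / z := by
    rw [← Real.rpow_add hz]; norm_num [Real.rpow_neg_one]
  rw [div_le_iff₀ (by positivity)]
  have g : x ^ (-(5 / 4) : ℝ) * y ^ (-(5 / 4) : ℝ) * (x * y) ^ (1 / 4 : ℝ) = 1 / (x * y) := by
    rw [Real.mul_rpow px.le py.le]
    calc _ = (x ^ (-(5 / 4) : ℝ) * x ^ (1 / 4 : ℝ)) * (y ^ (-(5 / 4) : ℝ) * y ^ (1 / 4 : ℝ)) := by ring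
      _ = _ := by rw [f x px, f y py]; field_simp
  set A := x ^ (-(5 / 4) : ℝ) * y ^ (-(5 / 4) : ℝ) with hA
  have pA : 0 < A := by positivity
  have k1 : 1 ≤ A * (x * y) * (x + y) ^ (1 / 2 : ℝ) := by
    calc (1:ℝ) = A * (x * y) ^ (1 / 4 : ℝ) * (x * y) := by rw [g]; field_simp
      _ = A * (x * y) * (x * y) ^ (1 / 4 : ℝ) := by ring
      _ ≤ _ := by gcongr
  calc h (p.1 + p.2 + 2) ^ 3 ≤ 343 * (x + y) ^ (1 / 2 : ℝ) := b3
    _ ≤ 343 * (x + y) ^ (1 / 2 : ℝ) * (A * (x * y) * (x + y) ^ (1 / 2 : ℝ)) :=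
        le_mul_of_one_le_right (by positivity) k1
    _ = 343 * A * (x * y * ((x + y) ^ (1 / 2 : ℝ) * (x + y) ^ (1 / 2 : ℝ))) := by ring
    _ = _ := by rw [d]

lemma tendsto_h_div : Filter.Tendsto (fun n : ℕ => h n / n) Filter.atTop (nhds 0) := by
  rw [← Filter.tendsto_add_atTop_iff_nat 1]
  exact tendsto_ratio.congr fun n => by rw [ratio]; push_cast; rfl

lemma hasSum_inv_four_sq_sub_sq (K : ℕ) :
    HasSum (fun m : ℕ => 1 / (2 * ((m : ℝ) + 1) - (2 * K + 1)) - 1 / (2 * ((m : ℝ) + 1) + (2 * K + 1)))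
      (1 / (2 * (K : ℝ) + 1)) := by
  have t : Filter.Tendsto (fun m : ℕ => 1 / (2 * ((m : ℝ) + 1) - (2 * K + 1))) Filter.atTop (nhds 0) := by
    rw [← Filter.tendsto_add_atTop_iff_nat K]
    refine tendsto_one_div_two_mul_add_one.congr fun m => ?_
    push_cast; congr 1; ring
  have := hasSum_telescope_shift t K (fun m hm => by
    have : (K : ℝ) ≤ m := by exact_mod_cast hm
    apply one_div_le_one_div_of_le (by linarith); push_cast; linarith) (2 * K + 1)
  refine hasSum_of_eq this (fun m => by push_cast; ring) ?_
  rw [Finset.sum_range_succ]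
  have z : ∑ m ∈ Finset.range (2 * K), 1 / (2 * ((m : ℝ) + 1) - (2 * K + 1)) = 0 := by
    have r := Finset.sum_range_reflect (fun m : ℕ => 1 / (2 * ((m : ℝ) + 1) - (2 * K + 1))) (2 * K)
    have r' : ∑ m ∈ Finset.range (2 * K), 1 / (2 * (((2 * K - 1 - m : ℕ) : ℝ) + 1) - (2 * K + 1))
        = -∑ m ∈ Finset.range (2 * K), 1 / (2 * ((m : ℝ) + 1) - (2 * K + 1)) := by
      rw [← Finset.sum_neg_distrib]
      refine Finset.sum_congr rfl fun m hm => ?_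
      have e : ((2 * K - 1 - m : ℕ) : ℝ) = 2 * K - 1 - m := by
        have := Finset.mem_range.1 hm
        rw [Nat.cast_sub (by omega), Nat.cast_sub (by omega)]; push_cast; ring
      rw [e, ← one_div_neg_eq_neg_one_div]; congr 1; ring
    linarith
  rw [z]; push_cast; rw [zero_add]; congr 1; ring

lemma hasSum_h_add_sub_h_dist (K : ℕ) :
    HasSum (fun m : ℕ => (h (m + 1 + K) - h ((m + 1 - K) + (K - (m + 1)))) / ((m : ℝ) + 1))
      (2 * h2 K) := by
  induction K with
  | zero => simp [h2]
  | succ K ih =>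
    refine hasSum_of_eq (ih.add ((hasSum_inv_four_sq_sub_sq K).mul_left (2 / (2 * (K : ℝ) + 1))))
      (fun m => ?_) (by rw [h2_succ]; field_simp)
    have e1 : h (m + 1 + (K + 1)) = h (m + 1 + K) + 1 / (2 * ((m : ℝ) + 1) + (2 * K + 1)) := by
      rw [← add_assoc, h_succ]; push_cast; ring
    have ne : 2 * ((m : ℝ) + 1) - (2 * K + 1) ≠ 0 := by
      have : (2 * (m + 1) : ℤ) - (2 * K + 1) ≠ 0 := by omega
      exact_mod_cast this
    have e2 : h ((m + 1 - (K + 1)) + (K + 1 - (m + 1))) = h ((m + 1 - K) + (K - (m + 1)))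
        - 1 / (2 * ((m : ℝ) + 1) - (2 * K + 1)) := by
      rcases Nat.lt_or_ge m K with l | l
      · obtain ⟨i, rfl⟩ := Nat.exists_eq_add_of_lt l
        rw [show (m + 1 - (m + i + 1 + 1)) + (m + i + 1 + 1 - (m + 1)) = i + 1 by omega,
          show (m + 1 - (m + i + 1)) + (m + i + 1 - (m + 1)) = i by omega, h_succ, sub_eq_add_neg,
          ← one_div_neg_eq_neg_one_div]
        congr 2; push_cast; ring
      · obtain ⟨i, rfl⟩ := Nat.exists_eq_add_of_le l
        rw [show (K + i + 1 - (K + 1)) + (K + 1 - (K + i + 1)) = i by omega,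
          show (K + i + 1 - K) + (K - (K + i + 1)) = i + 1 by omega, h_succ]
        rw [show 2 * (((K + i : ℕ) : ℝ) + 1) - (2 * K + 1) = 2 * i + 1 by push_cast; ring]
        ring
    have ne2 : 2 * ((m : ℝ) + 1) + (2 * K + 1) ≠ 0 := by positivity
    rw [e1, e2]; field_simp; ring

lemma hasSum_h_mul_kernel {K : ℕ} (hK : 1 ≤ K) :
    HasSum (fun L : ℕ => h L * (1 / ((L : ℝ) - K) - 1 / ((L : ℝ) + K))) (2 * h2 K) := by
  have K1 : (1 : ℝ) ≤ K := by exact_mod_cast hK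
  have s0 : HasSum (fun m : ℕ => (h (m + K) - h ((m - K) + (K - m))) / (m : ℝ)) (2 * h2 K) := by
    rw [← hasSum_nat_add_iff' 1]
    exact hasSum_of_eq (hasSum_h_add_sub_h_dist K) (fun m => by push_cast; rfl) (by simp)
  have s1 : HasSum (fun L : ℕ => h L / ((L : ℝ) - K) - h (L + K) / (((L + K : ℕ) : ℝ) - K))
      (∑ L ∈ Finset.range K, h L / ((L : ℝ) - K)) := by
    refine hasSum_telescope_shift (q := fun L : ℕ => h L / ((L : ℝ) - K)) ?_ (K + 1) (fun L hL => ?_) K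
    · refine squeeze_zero' (g := fun L : ℕ => 2 * (h L / L)) ?_ ?_ (by simpa using tendsto_h_div.const_mul 2)
      all_goals
        filter_upwards [Filter.eventually_ge_atTop (2 * K)] with L hL
        have hL' : 2 * (K : ℝ) ≤ L := by exact_mod_cast hL
      · exact div_nonneg (h_nonneg _) (by linarith)
      · rw [← mul_div_assoc, div_le_div_iff₀ (by linarith) (by linarith)]
        nlinarith [h_nonneg L]
    · have hL' : (K : ℝ) + 1 ≤ L := by exact_mod_cast hL
      have o : 1 ≤ h L := by
        obtain ⟨i, rfl⟩ := Nat.exists_eq_add_of_le' (show 1 ≤ L by omega)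
        exact one_le_h_succ i
      have e : 1 / (2 * (L:ℝ) + 1) * (L - K) ≤ 1 := by
        rw [one_div_mul_eq_div, div_le_one (by linarith)]; linarith
      push_cast
      rw [div_le_div_iff₀ (by linarith) (by linarith), h_succ]
      nlinarith
  have s2 : HasSum (fun m : ℕ => h ((m - K) + (K - m)) / (m : ℝ)
      - h ((m + K - K) + (K - (m + K))) / ((m + K : ℕ) : ℝ))
      (∑ m ∈ Finset.range K, h ((m - K) + (K - m)) / (m : ℝ)) := by
    refine hasSum_telescope_shift (q := fun m : ℕ => h ((m - K) + (K - m)) / (m : ℝ)) ?_ (2 * K)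
      (fun m hm => ?_) K
    · refine squeeze_zero' (Filter.Eventually.of_forall fun m => div_nonneg (h_nonneg _) m.cast_nonneg) ?_
        tendsto_h_div
      filter_upwards [Filter.eventually_ge_atTop K] with m hm
      exact div_le_div_of_nonneg_right (h_mono (by omega)) m.cast_nonneg
    · obtain ⟨i, rfl⟩ := Nat.exists_eq_add_of_le (show K ≤ m by omega)
      have hi : (K : ℝ) ≤ i := by exact_mod_cast (show K ≤ i by omega)
      rw [show (K + i + 1 - K) + (K - (K + i + 1)) = i + 1 by omega,
        show (K + i - K) + (K - (K + i)) = i by omega, h_succ]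
      have o : 1 ≤ h i := by
        obtain ⟨l, rfl⟩ := Nat.exists_eq_add_of_le' (show 1 ≤ i by omega)
        exact one_le_h_succ l
      have e : 1 / (2 * (i:ℝ) + 1) * (K + i) ≤ 1 := by
        rw [one_div_mul_eq_div, div_le_one (by linarith)]; linarith
      push_cast
      rw [div_le_div_iff₀ (by linarith) (by linarith)]
      nlinarith
  have b : ∑ L ∈ Finset.range K, h L / ((L : ℝ) - K)
      + ∑ m ∈ Finset.range K, h ((m - K) + (K - m)) / (m : ℝ) = 0 := by
    have c1 : ∑ L ∈ Finset.range K, h L / ((L : ℝ) - K)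
        = ∑ L ∈ Finset.range (K + 1), h L / ((L : ℝ) - K) := by simp [Finset.sum_range_succ]
    have c2 : ∑ m ∈ Finset.range K, h ((m - K) + (K - m)) / (m : ℝ)
        = ∑ m ∈ Finset.range (K + 1), h ((m - K) + (K - m)) / (m : ℝ) := by
      simp [Finset.sum_range_succ, h_zero]
    rw [c1, c2, ← Finset.sum_range_reflect, ← Finset.sum_add_distrib]
    refine Finset.sum_eq_zero fun m hm => ?_
    have hm' : m ≤ K := by have := Finset.mem_range.1 hm; omega
    rw [show K + 1 - 1 - m = K - m by omega, show (m - K) + (K - m) = K - m by omega, Nat.cast_sub hm',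
      sub_sub_cancel_left, div_neg, neg_add_cancel]
  refine hasSum_of_eq ((s1.add s0).add s2) (fun m => ?_) (by linarith)
  rw [show (m + K - K) + (K - (m + K)) = m by omega]
  push_cast
  rw [add_sub_cancel_right, sub_div]
  ring

/-- The double sum `∑ a_k a_l h_k / (k + l)`. -/
noncomputable def crossSum : ℝ :=
  ∑' p : ℕ × ℕ, ratio p.1 * ratio p.2 * h (p.1 + 1) / ((p.1 : ℝ) + p.2 + 2)

lemma summable_cross : Summable fun p : ℕ × ℕ =>
    ratio p.1 * ratio p.2 * h (p.1 + 1) / ((p.1 : ℝ) + p.2 + 2) := by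
  refine summable_h_cube_div.of_nonneg_of_le (fun p => div_nonneg (mul_nonneg (mul_nonneg
    (ratio_nonneg _) (ratio_nonneg _)) (h_nonneg _)) (by positivity)) fun p => ?_
  have a1 : h (p.1 + 1) ≤ h (p.1 + p.2 + 2) := h_mono (by omega)
  have a2 : h (p.2 + 1) ≤ h (p.1 + p.2 + 2) := h_mono (by omega)
  have n1 := h_nonneg (p.1 + 1)
  have n2 := h_nonneg (p.2 + 1)
  have n3 := h_nonneg (p.1 + p.2 + 2)
  calc _ = h (p.1 + 1) * h (p.2 + 1) * h (p.1 + 1) /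
        (((p.1 : ℝ) + 1) * ((p.2 : ℝ) + 1) * ((p.1 : ℝ) + p.2 + 2)) := by
        rw [ratio, ratio]; field_simp
    _ ≤ h (p.1 + p.2 + 2) * h (p.1 + p.2 + 2) * h (p.1 + p.2 + 2) /
        (((p.1 : ℝ) + 1) * ((p.2 : ℝ) + 1) * ((p.1 : ℝ) + p.2 + 2)) := by gcongr
    _ = _ := by ring

lemma summable_gap_left : Summable fun p : ℕ × ℕ =>
    ratio p.1 * ratio (p.1 + p.2 + 1) * h (p.1 + 1) / ((p.2 : ℝ) + 1) := by
  refine summable_h_cube_div.of_nonneg_of_le (fun p => div_nonneg (mul_nonneg (mul_nonneg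
    (ratio_nonneg _) (ratio_nonneg _)) (h_nonneg _)) (by positivity)) fun p => ?_
  have a1 : h (p.1 + 1) ≤ h (p.1 + p.2 + 2) := h_mono (by omega)
  have n1 := h_nonneg (p.1 + 1)
  have n3 := h_nonneg (p.1 + p.2 + 2)
  calc _ = h (p.1 + 1) * h (p.1 + p.2 + 2) * h (p.1 + 1) /
        (((p.1 : ℝ) + 1) * ((p.2 : ℝ) + 1) * ((p.1 : ℝ) + p.2 + 2)) := by
        rw [ratio, ratio]; push_cast; field_simp; ring
    _ ≤ h (p.1 + p.2 + 2) * h (p.1 + p.2 + 2) * h (p.1 + p.2 + 2) /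
        (((p.1 : ℝ) + 1) * ((p.2 : ℝ) + 1) * ((p.1 : ℝ) + p.2 + 2)) := by gcongr
    _ = _ := by ring

lemma summable_gap_right : Summable fun p : ℕ × ℕ =>
    ratio p.1 * ratio (p.1 + p.2 + 1) * h (p.1 + p.2 + 2) / ((p.2 : ℝ) + 1) := by
  refine summable_h_cube_div.of_nonneg_of_le (fun p => div_nonneg (mul_nonneg (mul_nonneg
    (ratio_nonneg _) (ratio_nonneg _)) (h_nonneg _)) (by positivity)) fun p => ?_
  have a1 : h (p.1 + 1) ≤ h (p.1 + p.2 + 2) := h_mono (by omega)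
  have n1 := h_nonneg (p.1 + 1)
  have n3 := h_nonneg (p.1 + p.2 + 2)
  calc _ = h (p.1 + 1) * h (p.1 + p.2 + 2) * h (p.1 + p.2 + 2) /
        (((p.1 : ℝ) + 1) * ((p.2 : ℝ) + 1) * ((p.1 : ℝ) + p.2 + 2)) := by
        rw [ratio, ratio]; push_cast; field_simp; ring
    _ ≤ h (p.1 + p.2 + 2) * h (p.1 + p.2 + 2) * h (p.1 + p.2 + 2) /
        (((p.1 : ℝ) + 1) * ((p.2 : ℝ) + 1) * ((p.1 : ℝ) + p.2 + 2)) := by gcongr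
    _ = _ := by ring

lemma hasSum_antisymm : HasSum (fun p : ℕ × ℕ =>
    ratio p.1 * ratio p.2 * h (p.1 + 1) / ((p.2 : ℝ) - p.1)) (-gapSum) := by
  have e1 (p : ℕ × ℕ) : ratio p.1 * ratio (p.1 + p.2 + 1) * h (p.1 + 1) /
      (((p.1 + p.2 + 1 : ℕ) : ℝ) - p.1)
      = ratio p.1 * ratio (p.1 + p.2 + 1) * h (p.1 + 1) / ((p.2 : ℝ) + 1) := by
    congr 1; push_cast; ring
  have e2 (p : ℕ × ℕ) : ratio (p.1 + p.2 + 1) * ratio p.1 * h (p.1 + p.2 + 1 + 1) /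
      ((p.1 : ℝ) - ((p.1 + p.2 + 1 : ℕ) : ℝ))
      = -(ratio p.1 * ratio (p.1 + p.2 + 1) * h (p.1 + p.2 + 2) / ((p.2 : ℝ) + 1)) := by
    rw [← div_neg, mul_comm (ratio (p.1 + p.2 + 1))]; congr 1; push_cast; ring
  have s : Summable fun p : ℕ × ℕ => ratio p.1 * ratio p.2 * h (p.1 + 1) / ((p.2 : ℝ) - p.1) := by
    refine summable_of_pair_split (by simp) ?_ ?_
    · exact summable_gap_left.congr fun p => (e1 p).symm
    · exact summable_gap_right.neg.congr fun p => (e2 p).symm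
  rw [s.hasSum_iff, tsum_pair_split s]
  simp only [e1, e2, sub_self, div_zero, tsum_zero, zero_add]
  rw [gapSum, tsum_neg, ← sub_eq_add_neg, ← summable_gap_left.tsum_sub summable_gap_right, ← tsum_neg]
  exact tsum_congr fun p => by ring

lemma summable_ratio_cube : Summable fun k => ratio k ^ 3 :=
  ((summable_pair_diag summable_cross).mul_left 2).congr fun k => by
    dsimp only
    rw [ratio]; field_simp; ring

lemma hasSum_ratio_mul_row (k : ℕ) : HasSum (fun l : ℕ =>
    ratio k * ratio l * h (k + 1) / ((l : ℝ) - k) + ratio k * ratio l * h (k + 1) / ((k : ℝ) + l + 2))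
    (2 * (h2 (k + 1) * ratio k ^ 2) + ratio k ^ 3) := by
  have s := (hasSum_nat_add_iff' 1).2 (hasSum_h_mul_kernel (K := k + 1) (by omega))
  simp only [Finset.sum_range_one, h_zero, zero_mul, sub_zero] at s
  refine hasSum_of_eq ((s.mul_left (ratio k ^ 2)).add (hasSum_ite_eq k (ratio k ^ 3)))
    (fun l => ?_) (by ring)
  push_cast
  rw [add_sub_add_right_eq_sub]
  split_ifs with e
  · subst e
    rw [ratio, sub_self]; field_simp; ring
  · have ne : (l : ℝ) - k ≠ 0 := sub_ne_zero.2 (by exact_mod_cast e)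
    have ne2 : (l : ℝ) + 1 + (k + 1) ≠ 0 := by positivity
    have ne3 : (k : ℝ) + l + 2 ≠ 0 := by positivity
    rw [ratio, ratio]; field_simp; ring

lemma three_mul_tsum_h2_mul_ratio_sq :
    3 * ∑' k, h2 (k + 1) * ratio k ^ 2 + ∑' k, ratio k ^ 3 = crossSum := by
  have a := (hasSum_antisymm.add summable_cross.hasSum).prod_fiberwise fun k => hasSum_ratio_mul_row k
  have b := (summable_h2_mul_ratio_sq.hasSum.mul_left 2).add summable_ratio_cube.hasSum
  have c := a.unique b
  rw [← crossSum, ← tsum_h2_mul_ratio_sq_eq_gapSum] at c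
  linarith

open MeasureTheory in
lemma lintegral_comp_sub_div_two (f : ℝ → ENNReal) (s : ℝ) :
    ∫⁻ v, f v = ENNReal.ofReal (1 / 2) * ∫⁻ q, f ((s - q) / 2) := by
  have d (x : ℝ) : HasDerivAt (fun q => (s - q) / 2) (-1 / 2) x :=
    ((hasDerivAt_id x).const_sub s).div_const 2
  have := lintegral_image_eq_lintegral_abs_deriv_mul (f := fun q => (s - q) / 2) MeasurableSet.univ
    (fun x _ => (d x).hasDerivWithinAt) (fun a _ b _ e => by simpa using e) f
  have im : (fun q => (s - q) / 2) '' Set.univ = Set.univ :=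
    Set.eq_univ_of_forall fun v => ⟨s - 2 * v, trivial, by ring⟩
  rw [im, setLIntegral_univ, setLIntegral_univ] at this
  rw [this, ← lintegral_const_mul' _ _ ENNReal.ofReal_ne_top]
  norm_num

open MeasureTheory in
lemma lintegral_eq_two_mul_of_even (f : ℝ → ENNReal) (hf : ∀ q, f (-q) = f q) :
    ∫⁻ q, f q = 2 * ∫⁻ q in Set.Ioi (0:ℝ), f q := by
  have := lintegral_image_eq_lintegral_abs_deriv_mul (f := fun q : ℝ => -q) (measurableSet_Ioi (a := 0))
    (fun x _ => (hasDerivAt_neg x).hasDerivWithinAt) (fun a _ b _ e => by simpa using e) f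
  simp only [Set.image_neg_eq_neg, Set.neg_Ioi, neg_zero, hf, abs_neg, abs_one, ENNReal.ofReal_one,
    one_mul] at this
  rw [← lintegral_add_compl f (measurableSet_Ioi (a := (0:ℝ))), Set.compl_Ioi,
    setLIntegral_congr Iio_ae_eq_Iic.symm, this, two_mul]

open MeasureTheory in
lemma lintegral_sq_eq_rotate {g : ℝ → ENNReal} (hg : Measurable g) :
    (∫⁻ u in Set.Ioi (0:ℝ), g u) ^ 2
      = ∫⁻ p in Set.Ioi (0:ℝ), ∫⁻ q in Set.Ioo (0:ℝ) p, g ((p + q) / 2) * g ((p - q) / 2) := by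
  set G := (Set.Ioi (0:ℝ)).indicator g with hG
  have mG : Measurable G := hg.indicator measurableSet_Ioi
  rw [← lintegral_indicator measurableSet_Ioi, ← hG, sq]
  have inner (s : ℝ) : ∫⁻ v, G (s - v) * G v
      = ∫⁻ q in Set.Ioi (0:ℝ), G ((s + q) / 2) * G ((s - q) / 2) := by
    rw [lintegral_comp_sub_div_two _ s]
    have e (q : ℝ) : s - (s - q) / 2 = (s + q) / 2 := by ring
    simp only [e]
    rw [lintegral_eq_two_mul_of_even (fun q => G ((s + q) / 2) * G ((s - q) / 2))
      (fun q => by rw [mul_comm, ← sub_eq_add_neg, sub_neg_eq_add]), ← mul_assoc]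
    rw [show ENNReal.ofReal (1 / 2) * 2 = 1 by
      rw [← ENNReal.ofReal_ofNat, ← ENNReal.ofReal_mul (by norm_num)]; norm_num, one_mul]
  calc (∫⁻ u, G u) * ∫⁻ v, G v = ∫⁻ v, ∫⁻ u, G u * G v := by
        rw [← lintegral_const_mul _ mG]
        exact lintegral_congr fun v => (lintegral_mul_const _ mG).symm
    _ = ∫⁻ v, ∫⁻ s, G (s - v) * G v :=
        lintegral_congr fun v => (lintegral_sub_right_eq_self (fun u => G u * G v) v).symm
    _ = ∫⁻ s, ∫⁻ v, G (s - v) * G v := lintegral_lintegral_swap (by fun_prop)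
    _ = ∫⁻ s, (Set.Ioi (0:ℝ)).indicator
          (fun p => ∫⁻ q in Set.Ioo (0:ℝ) p, g ((p + q) / 2) * g ((p - q) / 2)) s := by
        refine lintegral_congr fun s => ?_
        rw [inner]
        by_cases hs : 0 < s
        · rw [Set.indicator_of_mem (Set.mem_Ioi.2 hs), ← Set.Iio_inter_Ioi,
            ← setLIntegral_indicator measurableSet_Iio]
          refine setLIntegral_congr_fun measurableSet_Ioi fun q hq => ?_
          have hq' : 0 < q := hq
          by_cases l : q < s
          · have h1 : (s + q) / 2 ∈ Set.Ioi (0:ℝ) := by simp only [Set.mem_Ioi]; linarith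
            have h2 : (s - q) / 2 ∈ Set.Ioi (0:ℝ) := by simp only [Set.mem_Ioi]; linarith
            simp only [hG, Set.indicator_of_mem h1, Set.indicator_of_mem h2,
              Set.indicator_of_mem (Set.mem_Iio.2 l)]
          · have h2 : (s - q) / 2 ∉ Set.Ioi (0:ℝ) := by simp only [Set.mem_Ioi]; linarith
            simp only [hG, Set.indicator_of_notMem h2, mul_zero,
              Set.indicator_of_notMem (show q ∉ Set.Iio s from l)]
        · rw [Set.indicator_of_notMem (show s ∉ Set.Ioi 0 from hs)]
          refine setLIntegral_eq_zero measurableSet_Ioi fun q hq => ?_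
          have hq' : 0 < q := hq
          have h2 : (s - q) / 2 ∉ Set.Ioi (0:ℝ) := by simp only [Set.mem_Ioi]; linarith
          simp only [hG, Set.indicator_of_notMem h2, mul_zero, Pi.zero_apply]
    _ = _ := lintegral_indicator measurableSet_Ioi _

lemma tanh_strictMono' : StrictMono tanh := strictMono_of_deriv_pos fun x => by
  rw [(hasDerivAt_tanh' x).deriv]; positivity

lemma image_tanh_Ioo (p : ℝ) : tanh '' Set.Ioo 0 p = Set.Ioo 0 (tanh p) := by
  ext x
  constructor
  · rintro ⟨u, hu, rfl⟩; exact ⟨tanh_pos' hu.1, tanh_strictMono' hu.2⟩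
  · rintro ⟨h0, h1⟩
    have l : x < 1 := h1.trans (tanh_lt_one p)
    have e : tanh (artanh x) = x := tanh_artanh ⟨by linarith, l⟩
    exact ⟨artanh x, ⟨artanh_pos ⟨h0, l⟩, tanh_strictMono'.lt_iff_lt.1 (by rwa [e])⟩, e⟩

open MeasureTheory in
lemma setLIntegral_tanh_substitution (g : ℝ → ENNReal) (p : ℝ) :
    ∫⁻ x in Set.Ioo (0:ℝ) (tanh p), g x
      = ∫⁻ u in Set.Ioo (0:ℝ) p, ENNReal.ofReal (1 / cosh u ^ 2) * g (tanh u) := by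
  rw [← image_tanh_Ioo, lintegral_image_eq_lintegral_abs_deriv_mul measurableSet_Ioo
    (fun x _ => (hasDerivAt_tanh' x).hasDerivWithinAt) tanh_injective.injOn]
  refine lintegral_congr fun u => ?_
  rw [abs_of_nonneg (by positivity)]

lemma tanh_sq_sub_tanh_sq (p q : ℝ) :
    tanh p ^ 2 - tanh q ^ 2 = sinh (p + q) * sinh (p - q) / (cosh p ^ 2 * cosh q ^ 2) := by
  have := (cosh_pos p).ne'
  have := (cosh_pos q).ne'
  rw [tanh_eq_sinh_div_cosh, tanh_eq_sinh_div_cosh, sinh_add, sinh_sub]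
  field_simp
  ring

open MeasureTheory in
lemma lintegral_artanh_kernel :
    ∫⁻ y in Set.Ioo (0:ℝ) 1, ∫⁻ z in Set.Ioo (0:ℝ) y,
      ENNReal.ofReal ((artanh y ^ 2 - artanh z ^ 2) ^ 2 / (y ^ 2 - z ^ 2))
      = ENNReal.ofReal ((7 / 4 * zeta 3) ^ 2) := by
  have z0 : 0 ≤ zeta 3 := tsum_nonneg fun _ => by positivity
  have g0 : ∫⁻ u in Set.Ioi (0:ℝ), ENNReal.ofReal (4 * u ^ 2 / sinh (2 * u))
      = ENNReal.ofReal (7 / 4 * zeta 3) := by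
    have e : ENNReal.ofReal (7 / 4 * zeta 3) = ENNReal.ofReal 2 * artanhIntegral 2 := by
      rw [artanhIntegral_two, ← ENNReal.ofReal_mul (by norm_num)]; congr 1; ring
    rw [e, artanhIntegral_eq_lintegral_sinh, ← lintegral_const_mul' _ _ ENNReal.ofReal_ne_top]
    refine lintegral_congr fun u => ?_
    rw [← ENNReal.ofReal_mul (by norm_num)]; congr 1; ring
  rw [ENNReal.ofReal_pow (by positivity), ← g0, lintegral_sq_eq_rotate (by fun_prop),
    lintegral_tanh_substitution]
  refine setLIntegral_congr_fun measurableSet_Ioi fun p hp => ?_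
  rw [setLIntegral_tanh_substitution, ← lintegral_const_mul' _ _ ENNReal.ofReal_ne_top]
  refine setLIntegral_congr_fun measurableSet_Ioo fun q hq => ?_
  have hq1 := hq.1
  have hq2 := hq.2
  have s1 : 0 < sinh (p + q) := sinh_pos_iff.2 (by linarith)
  have s2 : 0 < sinh (p - q) := sinh_pos_iff.2 (by linarith)
  have c1 := cosh_pos p
  have c2 := cosh_pos q
  rw [← ENNReal.ofReal_mul (by positivity), ← ENNReal.ofReal_mul (by positivity),
    artanh_tanh, artanh_tanh, tanh_sq_sub_tanh_sq, mul_div_cancel₀ _ (two_ne_zero),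
    mul_div_cancel₀ _ (two_ne_zero), ← ENNReal.ofReal_mul (by positivity)]
  congr 1
  field_simp
  ring

lemma sq_sub_mul_geom (K : ℕ) (y z : ℝ) :
    y ^ (2 * K) - z ^ (2 * K)
      = (y ^ 2 - z ^ 2) * ∑ j ∈ Finset.range K, z ^ (2 * j) * y ^ (2 * (K - 1 - j)) := by
  have := (Commute.all (z ^ 2) (y ^ 2)).mul_geom_sum₂ K
  simp only [← pow_mul] at this
  linarith

open MeasureTheory in
lemma lintegral_pow_kernel (K M : ℕ) {y : ℝ} (hy : 0 < y) :
    ∫⁻ z in Set.Ioo (0:ℝ) y, ENNReal.ofReal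
      ((y ^ (2 * K) - z ^ (2 * K)) * (y ^ (2 * M) - z ^ (2 * M)) / (y ^ 2 - z ^ 2))
      = ENNReal.ofReal ((h K + h M - h (K + M)) * y ^ (2 * (K + M) - 1)) := by
  have pw {z : ℝ} (hz : z ∈ Set.Ioo 0 y) :
      (y ^ (2 * K) - z ^ (2 * K)) * (y ^ (2 * M) - z ^ (2 * M)) / (y ^ 2 - z ^ 2)
      = ∑ j ∈ Finset.range K, (y ^ (2 * (K - 1 - j)) * y ^ (2 * M) * z ^ (2 * j)
        - y ^ (2 * (K - 1 - j)) * z ^ (2 * j + 2 * M)) := by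
    have : y ^ 2 - z ^ 2 ≠ 0 := by nlinarith [hz.1, hz.2]
    rw [sq_sub_mul_geom K, mul_assoc, mul_div_cancel_left₀ _ this, Finset.sum_mul]
    exact Finset.sum_congr rfl fun j _ => by ring
  rw [setLIntegral_congr_fun measurableSet_Ioo fun z hz => congrArg ENNReal.ofReal (pw hz)]
  have int : IntegrableOn (fun z : ℝ => ∑ j ∈ Finset.range K, (y ^ (2 * (K - 1 - j)) * y ^ (2 * M) * z ^ (2 * j)
      - y ^ (2 * (K - 1 - j)) * z ^ (2 * j + 2 * M))) (Set.Ioo 0 y) :=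
    (Continuous.integrableOn_Icc (by fun_prop)).mono_set Set.Ioo_subset_Icc_self
  rw [← ofReal_integral_eq_lintegral_ofReal int (ae_restrict_of_forall_mem measurableSet_Ioo
    fun z hz => by
      dsimp only [Pi.zero_apply]
      rw [← pw hz]
      have := hz.1
      have l := hz.2
      exact div_nonneg (mul_nonneg (sub_nonneg.2 (by gcongr)) (sub_nonneg.2 (by gcongr)))
        (sub_nonneg.2 (by gcongr))),
    ← integral_Ioc_eq_integral_Ioo, ← intervalIntegral.integral_of_le hy.le]
  congr 1
  rw [intervalIntegral.integral_finsetSum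
    (fun j _ => Continuous.intervalIntegrable (by fun_prop) _ _)]
  have ek : h K + h M - h (K + M) = ∑ j ∈ Finset.range K,
      (1 / (2 * (j : ℝ) + 1) - 1 / (2 * (j : ℝ) + 2 * M + 1)) := by
    have e : h (K + M) = h M + ∑ j ∈ Finset.range K, 1 / (2 * (j : ℝ) + 2 * M + 1) := by
      rw [add_comm K M, h, h, Finset.sum_range_add]
      congr 1
      exact Finset.sum_congr rfl fun j _ => by push_cast; congr 1; ring
    rw [e, Finset.sum_sub_distrib, h]
    ring
  rw [ek, Finset.sum_mul]
  refine Finset.sum_congr rfl fun j hj => ?_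
  have hj := Finset.mem_range.1 hj
  rw [intervalIntegral.integral_sub (Continuous.intervalIntegrable (by fun_prop) _ _)
    (Continuous.intervalIntegrable (by fun_prop) _ _), intervalIntegral.integral_const_mul,
    intervalIntegral.integral_const_mul, integral_pow, integral_pow]
  obtain ⟨i, rfl⟩ := Nat.exists_eq_add_of_lt hj
  rw [show j + i + 1 - 1 - j = i by omega, show 2 * (j + i + 1 + M) - 1 = 2 * j + 2 * i + 2 * M + 1 by omega]
  push_cast
  rw [zero_pow (by omega), zero_pow (by omega)]
  ring

lemma gap_nonneg (K M : ℕ) : 0 ≤ h K + h M - h (K + M) := by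
  induction M with
  | zero => simp [h_zero]
  | succ M ih =>
    rw [← add_assoc, h_succ, h_succ]
    have : 1 / (2 * ((K + M : ℕ) : ℝ) + 1) ≤ 1 / (2 * (M : ℝ) + 1) := by
      push_cast
      apply one_div_le_one_div_of_le (by positivity)
      linarith [(Nat.cast_nonneg K : (0:ℝ) ≤ K)]
    linarith

open MeasureTheory in
lemma lintegral_pow_kernel_pair (p : ℕ × ℕ) :
    ∫⁻ y in Set.Ioo (0:ℝ) 1, ENNReal.ofReal (ratio p.1 * ratio p.2 *
      ((h (p.1 + 1) + h (p.2 + 1) - h (p.1 + 1 + (p.2 + 1))) * y ^ (2 * (p.1 + 1 + (p.2 + 1)) - 1)))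
      = ENNReal.ofReal (ratio p.1 * ratio p.2 * (h (p.1 + 1) + h (p.2 + 1) - h (p.1 + 1 + (p.2 + 1)))
        / (2 * ((p.1 : ℝ) + p.2 + 2))) := by
  have c0 : 0 ≤ ratio p.1 * ratio p.2 * (h (p.1 + 1) + h (p.2 + 1) - h (p.1 + 1 + (p.2 + 1))) :=
    mul_nonneg (mul_nonneg (ratio_nonneg _) (ratio_nonneg _)) (gap_nonneg _ _)
  simp_rw [← mul_assoc, ENNReal.ofReal_mul c0]
  rw [lintegral_const_mul' _ _ ENNReal.ofReal_ne_top, lintegral_pow_Ioo, ← ENNReal.ofReal_mul c0]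
  rw [show 2 * (p.1 + 1 + (p.2 + 1)) - 1 = 2 * p.1 + 2 * p.2 + 3 by omega]
  congr 1
  push_cast
  field_simp
  ring

open MeasureTheory in
lemma hasSum_gap : HasSum (fun p : ℕ × ℕ => ratio p.1 * ratio p.2 *
    (h (p.1 + 1) + h (p.2 + 1) - h (p.1 + 1 + (p.2 + 1))) / (2 * ((p.1 : ℝ) + p.2 + 2)))
    ((7 / 4 * zeta 3) ^ 2) := by
  have r0 (p : ℕ × ℕ) := mul_nonneg (ratio_nonneg p.1) (ratio_nonneg p.2)
  refine hasSum_of_tsum_ofReal (fun p => div_nonneg (mul_nonneg (r0 p) (gap_nonneg _ _))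
    (by positivity)) (sq_nonneg _) ?_
  rw [← lintegral_artanh_kernel]
  have inner {y : ℝ} (hy : y ∈ Set.Ioo (0:ℝ) 1) : ∫⁻ z in Set.Ioo (0:ℝ) y,
      ENNReal.ofReal ((artanh y ^ 2 - artanh z ^ 2) ^ 2 / (y ^ 2 - z ^ 2))
      = ∑' p : ℕ × ℕ, ENNReal.ofReal (ratio p.1 * ratio p.2 *
      ((h (p.1 + 1) + h (p.2 + 1) - h (p.1 + 1 + (p.2 + 1))) * y ^ (2 * (p.1 + 1 + (p.2 + 1)) - 1))) := by
    rw [lintegral_ofReal_hasSum measurableSet_Ioo (φ := fun (p : ℕ × ℕ) z => ratio p.1 * ratio p.2 *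
      ((y ^ (2 * (p.1 + 1)) - z ^ (2 * (p.1 + 1))) * (y ^ (2 * (p.2 + 1)) - z ^ (2 * (p.2 + 1)))
        / (y ^ 2 - z ^ 2))) (fun i => by fun_prop)]
    · refine tsum_congr fun p => ?_
      simp_rw [ENNReal.ofReal_mul (r0 p)]
      rw [lintegral_const_mul' _ _ ENNReal.ofReal_ne_top, lintegral_pow_kernel _ _ hy.1]
    · intro p z hz
      have := hz.1
      have l := hz.2
      exact mul_nonneg (r0 p) (div_nonneg (mul_nonneg (sub_nonneg.2 (by gcongr))
        (sub_nonneg.2 (by gcongr))) (sub_nonneg.2 (by gcongr)))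
    · intro z hz
      have hz' : z ∈ Set.Ioo (0:ℝ) 1 := ⟨hz.1, hz.2.trans hy.2⟩
      have d := (hasSum_artanh_sq hy).sub (hasSum_artanh_sq hz')
      have d0 (k : ℕ) : 0 ≤ ratio k * y ^ (2 * k + 2) - ratio k * z ^ (2 * k + 2) := by
        have := hz.1
        have l := hz.2
        exact sub_nonneg.2 (mul_le_mul_of_nonneg_left (by gcongr) (ratio_nonneg k))
      refine hasSum_of_eq ((d.mul d (d.summable.mul_of_nonneg d.summable d0 d0)).div_const
        (y ^ 2 - z ^ 2)) (fun p => by ring) (by ring)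
  rw [setLIntegral_congr_fun measurableSet_Ioo fun y hy => inner hy,
    lintegral_tsum fun p => by fun_prop]
  exact tsum_congr fun p => (lintegral_pow_kernel_pair p).symm

lemma crossSum_eq : crossSum = (7 / 4 * zeta 3) ^ 2 + π ^ 6 / 128 := by
  have s := summable_cross.hasSum
  have s' := (Equiv.prodComm ℕ ℕ).hasSum_iff.2 s
  rw [← crossSum] at s s'
  have a := (s.add s').sub hasSum_ratio_triple
  have e := a.unique (hasSum_of_eq (hasSum_gap.mul_left 2) (fun p => ?_) rfl)
  · linarith
  · simp only [Function.comp_apply, Equiv.prodComm_apply, Prod.fst_swap, Prod.snd_swap]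
    rw [ratio.eq_def (p.1 + p.2 + 1), show p.1 + 1 + (p.2 + 1) = p.1 + p.2 + 1 + 1 by ring]
    push_cast
    field_simp
    ring

theorem stmt13 :
    Summable (fun k : ℕ => h2 (k + 1) * (h (k + 1)) ^ 2 / ((k : ℝ) + 1) ^ 2) ∧
    Summable (fun k : ℕ => (h (k + 1)) ^ 3 / ((k : ℝ) + 1) ^ 3) ∧
    (∑' k : ℕ, h2 (k + 1) * (h (k + 1)) ^ 2 / ((k : ℝ) + 1) ^ 2)
      = (315 / 128) * zeta 6 + (49 / 48) * (zeta 3) ^ 2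
        - (1 / 3) * (∑' k : ℕ, (h (k + 1)) ^ 3 / ((k : ℝ) + 1) ^ 3) := by
  have e1 (k : ℕ) : h2 (k + 1) * (h (k + 1)) ^ 2 / ((k : ℝ) + 1) ^ 2 = h2 (k + 1) * ratio k ^ 2 := by
    rw [ratio, div_pow, mul_div_assoc]
  have e2 (k : ℕ) : (h (k + 1)) ^ 3 / ((k : ℝ) + 1) ^ 3 = ratio k ^ 3 := by
    rw [ratio, div_pow]
  simp only [e1, e2]
  refine ⟨summable_h2_mul_ratio_sq, summable_ratio_cube, ?_⟩
  have a := three_mul_tsum_h2_mul_ratio_sq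
  rw [crossSum_eq] at a
  rw [zeta_six]
  linarith
end

section
/- The series ∑_{k=1}^∞ H_k²·H_k^{(2)}/k² converges and equals (41/12)·ζ(6) + 2·ζ(3)². -/
open Finset Real

namespace HarmonicSeries

lemma H_mono : Monotone H := fun m n hmn => by
  unfold H
  exact Finset.sum_le_sum_of_subset_of_nonneg (by simpa using hmn) fun i _ _ => by positivity

lemma one_le_H_succ (n : ℕ) : 1 ≤ H (n + 1) := by
  have := H_mono (show 1 ≤ n + 1 by lia)
  simpa [H] using this

lemma H_le_one_add_log (n : ℕ) : H n ≤ 1 + Real.log n := by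
  have := harmonic_le_one_add_log n
  simpa [H, harmonic] using this

/-- Sequences bounded by a constant times a power of the harmonic numbers. -/
def slow : Subalgebra ℝ (ℕ → ℝ) where
  carrier := {a | ∃ C : ℝ, ∃ p : ℕ, ∀ n, |a n| ≤ C * H (n + 1) ^ p}
  mul_mem' := by
    rintro a b ⟨C, p, ha⟩ ⟨D, q, hb⟩
    refine ⟨C * D, p + q, fun n => ?_⟩
    calc |(a * b) n| = |a n| * |b n| := by simp [abs_mul]
      _ ≤ (C * H (n + 1) ^ p) * (D * H (n + 1) ^ q) :=
        mul_le_mul (ha n) (hb n) (abs_nonneg _) ((abs_nonneg _).trans (ha n))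
      _ = _ := by ring
  add_mem' := by
    rintro a b ⟨C, p, ha⟩ ⟨D, q, hb⟩
    refine ⟨|C| + |D|, p + q, fun n => ?_⟩
    have h1 := one_le_H_succ n
    calc |(a + b) n| ≤ |a n| + |b n| := by simpa using abs_add_le _ _
      _ ≤ C * H (n + 1) ^ p + D * H (n + 1) ^ q := add_le_add (ha n) (hb n)
      _ ≤ |C| * H (n + 1) ^ (p + q) + |D| * H (n + 1) ^ (p + q) := by
        gcongr
        · exact le_abs_self C
        · lia
        · exact le_abs_self D
        · lia
      _ = _ := by ring
  algebraMap_mem' := fun r => ⟨|r|, 0, fun n => by simp⟩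

lemma exists_abs_le_rpow (a : slow) :
    ∃ K : ℝ, 0 ≤ K ∧ ∀ n : ℕ, |a.1 n| ≤ K * ((n : ℝ) + 1) ^ (1 / 4 : ℝ) := by
  obtain ⟨a, C, p, ha⟩ := a
  set ε : ℝ := 1 / (4 * (p + 1)) with hε
  have hε0 : 0 < ε := by positivity
  refine ⟨|C| * (1 + 1 / ε) ^ p, by positivity, fun n => (ha n).trans ?_⟩
  have hx : (1 : ℝ) ≤ (n : ℝ) + 1 := by simp
  have hH : H (n + 1) ≤ (1 + 1 / ε) * ((n : ℝ) + 1) ^ ε := by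
    have h1 := H_le_one_add_log (n + 1)
    have h2 := Real.log_le_rpow_div (x := (n : ℝ) + 1) (by positivity) hε0
    have h3 := Real.one_le_rpow hx hε0.le
    push_cast at h1
    calc H (n + 1) ≤ _ := h1
      _ ≤ ((n : ℝ) + 1) ^ ε + ((n : ℝ) + 1) ^ ε / ε := add_le_add h3 h2
      _ = _ := by ring
  have hH0 : 0 ≤ H (n + 1) := zero_le_one.trans (one_le_H_succ n)
  calc C * H (n + 1) ^ p ≤ |C| * ((1 + 1 / ε) * ((n : ℝ) + 1) ^ ε) ^ p := by
        gcongr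
        exact le_abs_self C
    _ = |C| * (1 + 1 / ε) ^ p * ((n : ℝ) + 1) ^ (ε * p) := by
        rw [mul_pow, ← Real.rpow_mul_natCast (by positivity)]; ring
    _ ≤ _ := by
        gcongr
        rw [hε, div_mul_eq_mul_div, div_le_div_iff₀ (by positivity) (by positivity)]
        linarith

lemma rpow_quarter_pow_four (n : ℕ) : (((n : ℝ) + 1) ^ (1 / 4 : ℝ)) ^ 4 = (n : ℝ) + 1 := by
  rw [← Real.rpow_mul_natCast (by positivity)]
  norm_num

lemma summable_one_div_rpow_quarter_pow_five :
    Summable fun n : ℕ => 1 / (((n : ℝ) + 1) ^ (1 / 4 : ℝ)) ^ 5 := by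
  have := (Real.summable_one_div_nat_add_rpow 1 (5 / 4)).2 (by norm_num)
  refine this.congr fun n => ?_
  rw [abs_of_nonneg (by positivity), ← Real.rpow_mul_natCast (by positivity)]
  norm_num

lemma summable_kernel (a b : slow) : Summable fun q : ℕ × ℕ =>
    a.1 q.1 * b.1 q.2 / (((q.1 : ℝ) + 1) * ((q.2 : ℝ) + 1) * ((q.1 : ℝ) + q.2 + 2)) := by
  obtain ⟨K, hK, ha⟩ := exists_abs_le_rpow a
  obtain ⟨M, hM, hb⟩ := exists_abs_le_rpow b
  have hs := summable_one_div_rpow_quarter_pow_five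
  refine Summable.of_norm_bounded
    ((hs.mul_of_nonneg hs (fun n => by positivity) (fun n => by positivity)).mul_left (K * M)) ?_
  rintro ⟨n, k⟩
  have ha := ha n
  have hb := hb k
  have hu := rpow_quarter_pow_four n
  have hv := rpow_quarter_pow_four k
  have hu0 : 0 < ((n : ℝ) + 1) ^ (1 / 4 : ℝ) := by positivity
  have hv0 : 0 < ((k : ℝ) + 1) ^ (1 / 4 : ℝ) := by positivity
  dsimp only
  rw [show (n : ℝ) + k + 2 = (n + 1) + (k + 1) by ring]
  generalize ((n : ℝ) + 1) ^ (1 / 4 : ℝ) = u at *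
  generalize ((k : ℝ) + 1) ^ (1 / 4 : ℝ) = v at *
  rw [← hu, ← hv, Real.norm_eq_abs, abs_div, abs_mul,
    abs_of_pos (show 0 < u ^ 4 * v ^ 4 * (u ^ 4 + v ^ 4) by positivity)]
  calc |a.1 n| * |b.1 k| / (u ^ 4 * v ^ 4 * (u ^ 4 + v ^ 4))
      ≤ (K * u) * (M * v) / (u ^ 4 * v ^ 4 * (u ^ 2 * v ^ 2)) := by
        gcongr
        nlinarith [sq_nonneg (u ^ 2 - v ^ 2), sq_nonneg (u ^ 2 + v ^ 2)]
    _ = _ := by field_simp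

lemma summable_div_sq (a : slow) : Summable fun n : ℕ => a.1 n / ((n : ℝ) + 1) ^ 2 := by
  obtain ⟨K, hK, ha⟩ := exists_abs_le_rpow a
  refine Summable.of_norm_bounded (summable_one_div_rpow_quarter_pow_five.mul_left K) fun n => ?_
  have ha := ha n
  have hu := rpow_quarter_pow_four n
  have hu1 : 1 ≤ ((n : ℝ) + 1) ^ (1 / 4 : ℝ) := Real.one_le_rpow (by simp) (by norm_num)
  generalize ((n : ℝ) + 1) ^ (1 / 4 : ℝ) = u at *
  have hu0 : 0 < u := by linarith
  rw [← hu, Real.norm_eq_abs, abs_div, abs_of_pos (show 0 < (u ^ 4) ^ 2 by positivity)]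
  calc |a.1 n| / (u ^ 4) ^ 2 ≤ (K * u) / (u ^ 6 * 1) := by
        gcongr
        calc u ^ 6 * 1 ≤ u ^ 6 * u ^ 2 := by gcongr; exact one_le_pow₀ hu1
          _ = _ := by ring
    _ = _ := by field_simp

/-- The sequence `1 / n`, indexed from `n = 1`. -/
noncomputable def ι : slow :=
  ⟨fun n => 1 / ((n : ℝ) + 1), 1, 0, fun n => by
    rw [abs_of_nonneg (by positivity), pow_zero, mul_one, div_le_one (by positivity)]
    simp⟩

/-- Strict nested summation `(S a)ₙ = ∑_{i < n} aᵢ / i`. -/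
noncomputable def S : slow →ₗ[ℝ] slow where
  toFun a := ⟨fun n => ∑ i ∈ range n, a.1 i / ((i : ℝ) + 1), by
    obtain ⟨a, C, p, ha⟩ := a
    refine ⟨|C|, p + 1, fun n => ?_⟩
    have h0 : ∀ m, 0 ≤ H m := fun m => by unfold H; positivity
    calc |∑ i ∈ range n, a i / ((i : ℝ) + 1)|
        ≤ ∑ i ∈ range n, |a i / ((i : ℝ) + 1)| := Finset.abs_sum_le_sum_abs _ _
      _ ≤ ∑ i ∈ range n, |C| * H (n + 1) ^ p * (1 / ((i : ℝ) + 1)) := by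
        refine Finset.sum_le_sum fun i hi => ?_
        rw [abs_div, abs_of_pos (show (0 : ℝ) < (i : ℝ) + 1 by positivity), div_eq_mul_one_div]
        have hin := H_mono (show i + 1 ≤ n + 1 by have := Finset.mem_range.1 hi; lia)
        have := h0 (i + 1)
        gcongr
        exact (ha i).trans (by gcongr; exact le_abs_self C)
      _ = |C| * H (n + 1) ^ p * H n := by rw [← Finset.mul_sum]; rfl
      _ ≤ |C| * H (n + 1) ^ p * H (n + 1) := by
        have := h0 (n + 1)
        gcongr
        exact H_mono (Nat.le_succ n)
      _ = _ := by ring⟩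
  map_add' a b := by
    ext n
    simp [add_div, Finset.sum_add_distrib]
  map_smul' r a := by
    ext n
    simp [mul_div_assoc, Finset.mul_sum]

/-- The functional `∑ aₙ / n²`. -/
noncomputable def Z : slow →ₗ[ℝ] ℝ where
  toFun a := ∑' n : ℕ, a.1 n / ((n : ℝ) + 1) ^ 2
  map_add' a b := by
    rw [← (summable_div_sq a).tsum_add (summable_div_sq b)]
    simp [add_div]
  map_smul' r a := by
    simp [mul_div_assoc, tsum_mul_left]

lemma hasSum_Z (a : slow) : HasSum (fun n : ℕ => a.1 n / ((n : ℝ) + 1) ^ 2) (Z a) :=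
  (summable_div_sq a).hasSum

lemma coe_S (a : slow) (n : ℕ) : (S a).1 n = ∑ i ∈ range n, a.1 i / ((i : ℝ) + 1) := rfl

lemma coe_S_zero (a : slow) : (S a).1 0 = 0 := by simp [coe_S]

lemma coe_S_succ (a : slow) (n : ℕ) : (S a).1 (n + 1) = (S a).1 n + a.1 n / ((n : ℝ) + 1) := by
  simp [coe_S, Finset.sum_range_succ]

lemma coe_mul (a b : slow) (n : ℕ) : (a * b).1 n = a.1 n * b.1 n := rfl

lemma coe_add (a b : slow) (n : ℕ) : (a + b).1 n = a.1 n + b.1 n := rfl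

lemma coe_sub (a b : slow) (n : ℕ) : (a - b).1 n = a.1 n - b.1 n := rfl

lemma coe_one (n : ℕ) : (1 : slow).1 n = 1 := rfl

lemma coe_ι (n : ℕ) : ι.1 n = 1 / ((n : ℝ) + 1) := rfl

lemma S_mul_S (a b : slow) : S a * S b = S (a * S b + b * S a + ι * a * b) := by
  ext n
  induction n with
  | zero => simp [coe_mul, coe_S_zero]
  | succ n ih =>
    rw [coe_S_succ, ← ih]
    simp only [coe_mul, coe_add, coe_S_succ, coe_ι]
    field_simp
    ring

lemma tendsto_S_ι_mul (a : slow) :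
    Filter.Tendsto (S (ι * a)).1 Filter.atTop (nhds (Z a)) := by
  refine (hasSum_Z a).tendsto_sum_nat.congr fun n => ?_
  rw [coe_S]
  refine Finset.sum_congr rfl fun i _ => ?_
  rw [coe_mul, coe_ι]
  field_simp

lemma Z_mul_Z (a b : slow) :
    Z a * Z b = Z (a * S (ι * b)) + Z (b * S (ι * a)) + Z (ι ^ 2 * a * b) := by
  rw [← map_add, ← map_add]
  refine tendsto_nhds_unique ((tendsto_S_ι_mul a).mul (tendsto_S_ι_mul b)) ?_
  refine (tendsto_S_ι_mul _).congr fun n => ?_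
  rw [← coe_mul, S_mul_S, show ι * a * S (ι * b) + ι * b * S (ι * a) + ι * (ι * a) * (ι * b) =
    ι * (a * S (ι * b) + b * S (ι * a) + ι ^ 2 * a * b) by ring]

lemma summable_kernel_right (a : slow) (k : ℕ) :
    Summable fun n : ℕ => a.1 n / (((n : ℝ) + 1) * ((n : ℝ) + k + 2)) := by
  have := ((summable_kernel a 1).comp_injective (Prod.mk_left_injective k)).mul_left ((k : ℝ) + 1)
  refine this.congr fun n => ?_
  simp only [Function.comp, coe_one]
  field_simp

/-- `IsKernelTransform a c` says that `cₖ = ∑ₙ aₙ k / (n (n + k))` for all `k ≥ 1`. -/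
def IsKernelTransform (a c : slow) : Prop :=
  ∀ k : ℕ, HasSum (fun n : ℕ => a.1 n * ((k : ℝ) + 1) / (((n : ℝ) + 1) * ((n : ℝ) + k + 2))) (c.1 k)

lemma IsKernelTransform.Z_mul_comm {a b c d : slow} (ha : IsKernelTransform a c)
    (hb : IsKernelTransform b d) : Z (b * c) = Z (a * d) := by
  have h := (summable_kernel a b).tsum_comm
    (f := fun n k : ℕ => a.1 n * b.1 k / (((n : ℝ) + 1) * ((k : ℝ) + 1) * ((n : ℝ) + k + 2)))
  refine Eq.trans (tsum_congr fun k => ?_) (h.trans (tsum_congr fun n => ?_))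
  · rw [coe_mul, ← (ha k).tsum_eq, mul_div_assoc, ← tsum_div_const, ← tsum_mul_left]
    refine tsum_congr fun n => ?_
    field_simp
  · rw [coe_mul, ← (hb n).tsum_eq, mul_div_assoc, ← tsum_div_const, ← tsum_mul_left]
    refine tsum_congr fun k => ?_
    rw [show (k : ℝ) + n + 2 = n + k + 2 by ring]
    field_simp

lemma IsKernelTransform.ι_mul {a c : slow} (ha : IsKernelTransform a c) :
    IsKernelTransform (ι * a) (Z a • 1 - ι * c) := by
  intro k
  have h := (hasSum_Z a).sub ((ha k).mul_left (1 / ((k : ℝ) + 1)))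
  have hc : (Z a • 1 - ι * c).1 k = Z a - 1 / ((k : ℝ) + 1) * c.1 k := by
    rw [coe_sub, coe_mul, coe_ι]
    simp
  rw [hc]
  refine h.congr_fun fun n => ?_
  rw [coe_mul, coe_ι]
  field_simp
  ring

lemma tendsto_div_add (a : slow) (k : ℕ) :
    Filter.Tendsto (fun n : ℕ => a.1 n / ((n : ℝ) + k + 1)) Filter.atTop (nhds 0) := by
  obtain ⟨K, hK, ha⟩ := exists_abs_le_rpow a
  have h1 : Filter.Tendsto (fun n : ℕ => K * ((n : ℝ) + 1) ^ (-(3 / 4) : ℝ)) Filter.atTop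
      (nhds 0) := by
    have := (tendsto_rpow_neg_atTop (show (0 : ℝ) < 3 / 4 by norm_num)).comp
      (Filter.tendsto_atTop_add_const_right _ (1 : ℝ) tendsto_natCast_atTop_atTop)
    simpa using this.const_mul K
  refine squeeze_zero_norm (fun n => ?_) h1
  rw [Real.norm_eq_abs, abs_div, abs_of_pos (show 0 < (n : ℝ) + k + 1 by positivity)]
  have hx : (0 : ℝ) < (n : ℝ) + 1 := by positivity
  calc |a.1 n| / ((n : ℝ) + k + 1) ≤ K * ((n : ℝ) + 1) ^ (1 / 4 : ℝ) / ((n : ℝ) + 1) := by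
        have := ha n
        gcongr
        simp
    _ = K * ((n : ℝ) + 1) ^ (1 / 4 - 1 : ℝ) := by
        rw [Real.rpow_sub_one hx.ne', mul_div_assoc]
    _ = _ := by norm_num

lemma hasSum_S_mul_sub (a : slow) {c : ℝ} {k : ℕ}
    (ha : HasSum (fun n : ℕ => a.1 n / (((n : ℝ) + 1) * ((n : ℝ) + k + 2))) c) :
    HasSum (fun n : ℕ => (S a).1 n * (1 / ((n : ℝ) + k + 1) - 1 / ((n : ℝ) + k + 2))) c := by
  have hs : Summable
      fun n : ℕ => (S a).1 n * (1 / ((n : ℝ) + k + 1) - 1 / ((n : ℝ) + k + 2)) := by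
    refine Summable.of_norm_bounded (summable_div_sq (S a)).norm fun n => ?_
    rw [norm_mul, norm_div, div_eq_mul_one_div ‖_‖]
    gcongr
    rw [show 1 / ((n : ℝ) + k + 1) - 1 / ((n : ℝ) + k + 2)
      = 1 / (((n : ℝ) + k + 1) * ((n : ℝ) + k + 2)) by field_simp; ring,
      Real.norm_of_nonneg (by positivity), Real.norm_of_nonneg (by positivity), sq]
    gcongr <;> linarith [(Nat.cast_nonneg k : (0 : ℝ) ≤ k)]
  have h1 := ha.tendsto_sum_nat.sub (tendsto_div_add (S a) k)
  rw [sub_zero] at h1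
  refine (hs.hasSum_iff_tendsto_nat).2 (h1.congr fun N => ?_)
  induction N with
  | zero => simp [coe_S_zero]
  | succ N ih =>
    rw [Finset.sum_range_succ, Finset.sum_range_succ, ← ih, coe_S_succ]
    push_cast
    field_simp
    ring

lemma IsKernelTransform.S {a c : slow} (ha : IsKernelTransform a c) :
    IsKernelTransform (S a) (S c + ι * c) := by
  have hstep (k : ℕ) := hasSum_S_mul_sub a (k := k) (c := c.1 k / ((k : ℝ) + 1)) <| by
    rw [div_eq_mul_one_div, mul_comm]
    refine ((ha k).mul_left (1 / ((k : ℝ) + 1))).congr_fun fun n => ?_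
    field_simp
  intro k
  induction k with
  | zero =>
    convert hstep 0 using 1
    · ext n
      push_cast
      field_simp
      ring
    · simp [coe_add, coe_mul, coe_ι, coe_S_zero]
  | succ k ih =>
    convert ih.add (hstep (k + 1)) using 1
    · ext n
      push_cast
      field_simp
      ring
    · rw [coe_add, coe_mul, coe_ι, coe_add, coe_mul, coe_ι, coe_S_succ]
      push_cast
      field_simp

lemma isKernelTransform_one : IsKernelTransform 1 (S 1 + ι) := by
  intro k
  have hs := summable_kernel_right 1 k
  have key (N : ℕ) : ∑ n ∈ range N, (1 : slow).1 n * ((k : ℝ) + 1) /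
      (((n : ℝ) + 1) * ((n : ℝ) + k + 2)) =
      (S 1).1 (k + 1) - ∑ j ∈ range (k + 1), (1 : ℝ) / ((N : ℝ) + j + 1) := by
    induction N with
    | zero => simp [coe_S, coe_one]
    | succ N ih =>
      have h1 := Finset.sum_range_succ' (fun j : ℕ => (1 : ℝ) / ((N : ℝ) + j + 1)) (k + 1)
      rw [Finset.sum_range_succ] at h1
      have h2 : ∑ j ∈ range (k + 1), (1 : ℝ) / (((N + 1 : ℕ) : ℝ) + j + 1) =
          ∑ j ∈ range (k + 1), (1 : ℝ) / ((N : ℝ) + (j + 1 : ℕ) + 1) :=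
        Finset.sum_congr rfl fun j _ => by push_cast; ring
      have h3 : (1 : slow).1 N * ((k : ℝ) + 1) / (((N : ℝ) + 1) * ((N : ℝ) + k + 2)) =
          1 / ((N : ℝ) + 1) - 1 / ((N : ℝ) + (k + 1 : ℕ) + 1) := by
        rw [coe_one]
        push_cast
        field_simp
        ring
      rw [Finset.sum_range_succ, ih, h2, h3]
      simp only [Nat.cast_zero, add_zero] at h1
      linarith
  have hlim : Filter.Tendsto (fun N : ℕ => (S 1).1 (k + 1) -
      ∑ j ∈ range (k + 1), (1 : ℝ) / ((N : ℝ) + j + 1)) Filter.atTop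
      (nhds ((S 1).1 (k + 1) - ∑ j ∈ range (k + 1), (0 : ℝ))) :=
    tendsto_const_nhds.sub (tendsto_finsetSum _ fun j _ => tendsto_div_add 1 j)
  have hval : (S 1 + ι).1 k = (S 1).1 (k + 1) - ∑ j ∈ range (k + 1), (0 : ℝ) := by
    rw [coe_add, coe_S_succ, coe_ι, coe_one]
    simp
  rw [hval]
  have hs' : Summable fun n : ℕ => (1 : slow).1 n * ((k : ℝ) + 1) /
      (((n : ℝ) + 1) * ((n : ℝ) + k + 2)) :=
    (hs.mul_left ((k : ℝ) + 1)).congr fun n => by ring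
  exact hs'.hasSum_iff_tendsto_nat.2 (hlim.congr fun N => (key N).symm)

/-- Summing over pairs by grouping on `N = n + k`. -/
lemma hasSum_Z_mul_S (a c : slow) (hc : ∀ n, |c.1 n| ≤ 1) :
    HasSum (fun q : ℕ × ℕ => c.1 (q.1 + q.2 + 1) * a.1 q.1 /
      (((q.1 : ℝ) + 1) * ((q.1 : ℝ) + q.2 + 2) ^ 2)) (Z (c * S a)) := by
  have hs : Summable (fun q : ℕ × ℕ => c.1 (q.1 + q.2 + 1) * a.1 q.1 /
      (((q.1 : ℝ) + 1) * ((q.1 : ℝ) + q.2 + 2) ^ 2)) := by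
    refine Summable.of_norm_bounded (summable_kernel a 1).norm ?_
    rintro ⟨k, n⟩
    dsimp only
    rw [coe_one, mul_comm (a.1 k) 1, norm_div, norm_div, norm_mul (c.1 _), norm_mul (1 : ℝ),
      norm_one, Real.norm_of_nonneg (show 0 ≤ ((k : ℝ) + 1) * ((k : ℝ) + n + 2) ^ 2 by positivity),
      Real.norm_of_nonneg (show 0 ≤ ((k : ℝ) + 1) * (n + 1) * (k + n + 2) by positivity)]
    gcongr ?_ * _ / ?_
    · exact hc _
    · calc ((k : ℝ) + 1) * (n + 1) * (k + n + 2) ≤ (k + 1) * (k + n + 2) * (k + n + 2) := by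
            gcongr <;> linarith [(Nat.cast_nonneg k : (0 : ℝ) ≤ k)]
        _ = _ := by ring
  have h1 := (Finset.HasAntidiagonal.sigmaAntidiagonalEquivProd.hasSum_iff.2 hs.hasSum).sigma
    fun M => hasSum_fintype _
  have h2 := (hasSum_nat_add_iff' 1).2 (hasSum_Z (c * S a))
  simp only [Finset.sum_range_one, coe_mul, coe_S_zero, mul_zero, zero_div, sub_zero] at h2
  have h3 := h1.unique (h2.congr_fun fun M => ?_)
  · rw [← h3]
    exact hs.hasSum
  · simp only [Function.comp, Finset.HasAntidiagonal.sigmaAntidiagonalEquivProd_apply]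
    rw [Finset.univ_eq_attach, Finset.sum_attach (antidiagonal M) (fun q : ℕ × ℕ =>
      c.1 (q.1 + q.2 + 1) * a.1 q.1 / (((q.1 : ℝ) + 1) * ((q.1 : ℝ) + q.2 + 2) ^ 2)),
      Finset.Nat.sum_antidiagonal_eq_sum_range_succ_mk, coe_S, Finset.mul_sum, Finset.sum_div]
    refine Finset.sum_congr rfl fun k hk => ?_
    have hkM : k ≤ M := by have := Finset.mem_range.1 hk; lia
    simp only [Nat.add_sub_cancel' hkM, Nat.cast_sub hkM]
    push_cast
    rw [show (k : ℝ) + (M - k) + 2 = M + 1 + 1 by ring]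
    field_simp

lemma IsKernelTransform.hasSum_prod {c : slow} (hc : IsKernelTransform 1 c) (a : slow) :
    HasSum (fun q : ℕ × ℕ => a.1 q.1 /
      (((q.1 : ℝ) + 1) * ((q.2 : ℝ) + 1) * ((q.1 : ℝ) + q.2 + 2))) (Z (a * c)) := by
  have hs := summable_kernel a 1
  simp only [coe_one, mul_one] at hs
  have h := hs.hasSum.prod_fiberwise (g := fun k => (a * c).1 k / ((k : ℝ) + 1) ^ 2) fun k => by
    rw [coe_mul, mul_div_right_comm]
    refine ((hc k).mul_left _).congr_fun fun n => ?_
    rw [coe_one]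
    field_simp
    ring
  rw [← h.unique (hasSum_Z _)]
  exact hs.hasSum

lemma abs_ι_pow_le_one (p n : ℕ) : |(ι ^ p).1 n| ≤ 1 := by
  have h : (ι ^ p).1 n = (1 / ((n : ℝ) + 1)) ^ p := rfl
  rw [h, abs_of_nonneg (by positivity)]
  exact pow_le_one₀ (by positivity) (by rw [div_le_one (by positivity)]; simp)

lemma coe_ι_pow (p n : ℕ) : (ι ^ p).1 n = 1 / ((n : ℝ) + 1) ^ p := by
  have h : (ι ^ p).1 n = (1 / ((n : ℝ) + 1)) ^ p := rfl
  rw [h, one_div_pow]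

lemma Z_ι_pow (p : ℕ) : Z (ι ^ p) = zeta (p + 2) := by
  refine tsum_congr fun n => ?_
  rw [coe_ι_pow]
  field_simp
  ring

/-- Euler's evaluation `ζ(2, 1) = ζ(3)`. -/
lemma Z_S_one : Z (S 1) = Z ι := by
  have h0 := isKernelTransform_one.hasSum_prod 1
  have h1 := hasSum_Z_mul_S 1 1 fun n => by simp [coe_one]
  have h2 := (Equiv.prodComm ℕ ℕ).hasSum_iff.2 h1
  have h3 := h0.unique ((h1.add h2).congr_fun fun q => by
    simp only [Function.comp, Equiv.prodComm_apply, Prod.fst_swap, Prod.snd_swap, coe_one]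
    rw [show (q.2 : ℝ) + q.1 + 2 = q.1 + q.2 + 2 by ring]
    field_simp
    ring)
  simp only [one_mul, map_add] at h3
  linarith

/-- The shuffle product `ζ(3)² = 2ζ(3, 3) + 6ζ(4, 2) + 12ζ(5, 1)`. -/
lemma Z_ι_sq : Z ι ^ 2 = 2 * Z (ι * S (ι ^ 2)) + 6 * Z (ι ^ 2 * S ι) + 12 * Z (ι ^ 3 * S 1) := by
  have h1 := hasSum_Z_mul_S (ι ^ 2) (ι ^ 1) (abs_ι_pow_le_one _)
  have h2 := (hasSum_Z_mul_S (ι ^ 1) (ι ^ 2) (abs_ι_pow_le_one _)).mul_left 3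
  have h3 := (hasSum_Z_mul_S (ι ^ 0) (ι ^ 3) (abs_ι_pow_le_one _)).mul_left 6
  have h4 := (h1.add h2).add h3
  have h5 := h4.add ((Equiv.prodComm ℕ ℕ).hasSum_iff.2 h4)
  have h6 : HasSum (fun q : ℕ × ℕ => ι.1 q.1 / ((q.1 : ℝ) + 1) ^ 2 *
      (ι.1 q.2 / ((q.2 : ℝ) + 1) ^ 2)) _ := h5.congr_fun fun q => by
    simp only [Function.comp, Equiv.prodComm_apply, Prod.fst_swap, Prod.snd_swap, coe_ι_pow, coe_ι]
    rw [show (q.2 : ℝ) + q.1 + 2 = q.1 + q.2 + 2 by ring, Nat.add_comm q.2 q.1]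
    push_cast
    rw [show (q.1 : ℝ) + q.2 + 1 + 1 = (q.1 + 1) + (q.2 + 1) by ring,
      show (q.1 : ℝ) + q.2 + 2 = (q.1 + 1) + (q.2 + 1) by ring]
    have hx : (0 : ℝ) < (q.1 : ℝ) + 1 := by positivity
    have hy : (0 : ℝ) < (q.2 : ℝ) + 1 := by positivity
    generalize (q.1 : ℝ) + 1 = x at *
    generalize (q.2 : ℝ) + 1 = y at *
    field_simp
    ring
  have h7 := ((hasSum_Z ι).mul (hasSum_Z ι) h6.summable).unique h6
  simp only [pow_zero, pow_one] at h7
  linarith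

lemma hasSum_zeta (s : ℕ) {x : ℝ} (hs : s ≠ 0) (hx : HasSum (fun n : ℕ => 1 / (n : ℝ) ^ s) x) :
    zeta s = x := by
  have h := (hasSum_nat_add_iff' 1).2 hx
  simp only [Finset.sum_range_one, Nat.cast_zero, zero_pow hs, div_zero, sub_zero] at h
  unfold zeta
  rw [← h.tsum_eq]
  simp

lemma zeta_two_mul_zeta_four : zeta 2 * zeta 4 = 7 / 4 * zeta 6 := by
  have hb : bernoulli 6 = 1 / 42 := by
    rw [bernoulli_eq_bernoulli'_of_ne_one (by norm_num)]
    have h5 : bernoulli' 5 = 0 := bernoulli'_eq_zero_of_odd (by decide) (by norm_num)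
    rw [bernoulli'_def]
    norm_num [Finset.sum_range_succ, h5, Nat.choose]
  have h6 := hasSum_zeta_nat (k := 3) (by norm_num)
  norm_num [hb, Nat.factorial] at h6
  rw [hasSum_zeta 2 (by norm_num) hasSum_zeta_two, hasSum_zeta 4 (by norm_num) hasSum_zeta_four,
    hasSum_zeta 6 (by norm_num) (by simpa using h6)]
  ring

lemma zeta_two_sq : zeta 2 ^ 2 = 5 / 2 * zeta 4 := by
  rw [hasSum_zeta 2 (by norm_num) hasSum_zeta_two, hasSum_zeta 4 (by norm_num) hasSum_zeta_four]
  ring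

lemma S_one_sq : S 1 ^ 2 = 2 * S (S 1) + S ι := by
  rw [sq, S_mul_S]
  simp only [map_add, one_mul, mul_one]
  ring

lemma S_one_mul_S_ι : S 1 * S ι = S (S ι) + S (ι * S 1) + S (ι ^ 2) := by
  rw [S_mul_S]
  simp only [map_add, one_mul, mul_one, sq]

lemma S_one_mul_S_S_one : S 1 * S (S 1) = 3 * S (S (S 1)) + S (S ι) + S (ι * S 1) := by
  rw [S_mul_S, ← sq, S_one_sq, two_mul]
  simp only [map_add, one_mul, mul_one]
  ring

lemma S_ι_sq : S ι ^ 2 = 2 * S (ι * S ι) + S (ι ^ 3) := by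
  rw [sq, S_mul_S]
  simp only [map_add, pow_succ, pow_zero, one_mul]
  ring

lemma Z_two_mul (a : slow) : Z (2 * a) = 2 * Z a := by
  rw [two_mul, map_add, two_mul]

lemma Z_three_mul (a : slow) : Z (3 * a) = 3 * Z a := by
  rw [show 3 * a = a + a + a by ring, map_add, map_add]
  ring

lemma isKernelTransform_ι : IsKernelTransform ι (Z 1 • 1 - ι * (S 1 + ι)) := by
  simpa using isKernelTransform_one.ι_mul

lemma Z_weight_four : Z (S ι) = 3 / 4 * Z (ι ^ 2) ∧ Z (ι * S 1) = 1 / 4 * Z (ι ^ 2) ∧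
    Z (S (S 1)) = Z (ι ^ 2) ∧ Z 1 ^ 2 = 5 / 2 * Z (ι ^ 2) := by
  have k1 := isKernelTransform_one
  have hz : Z 1 ^ 2 = 5 / 2 * Z (ι ^ 2) := by
    rw [← pow_zero ι, Z_ι_pow, Z_ι_pow, zeta_two_sq]
  have p := Z_mul_Z 1 1
  have r1 := k1.Z_mul_comm isKernelTransform_ι
  have r2 := k1.Z_mul_comm k1.S
  have q := congrArg Z S_one_sq
  simp only [mul_add, mul_sub, map_add, map_sub, map_smul, smul_eq_mul, mul_one, one_mul,
    mul_smul_comm, Z_two_mul] at p r1 r2 q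
  ring_nf at p r1 r2 q hz ⊢
  refine ⟨?_, ?_, ?_, ?_⟩ <;> linarith

lemma Z_target : Z ((S 1 + ι) ^ 2 * (S ι + ι ^ 2)) = 41 / 12 * Z (ι ^ 4) + 2 * Z ι ^ 2 := by
  obtain ⟨m22, m31, m211, -⟩ := Z_weight_four
  have m21 := Z_S_one
  have hz : Z 1 * Z (ι ^ 2) = 7 / 4 * Z (ι ^ 4) := by
    rw [← pow_zero ι, Z_ι_pow, Z_ι_pow, Z_ι_pow, zeta_two_mul_zeta_four]
  have sf := Z_ι_sq
  have k1 := isKernelTransform_one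
  have kι := isKernelTransform_ι
  have kιι := kι.ι_mul
  have kS := k1.S
  have p1 := Z_mul_Z 1 (ι ^ 2)
  have p2 := Z_mul_Z ι ι
  have p3 := Z_mul_Z (S 1) ι
  have p4 := Z_mul_Z (S 1) (S 1)
  have p5 := Z_mul_Z 1 (S ι)
  have r1 := kι.Z_mul_comm kιι
  have r2 := kS.Z_mul_comm kιι
  have r3 := kι.S.Z_mul_comm kι
  have r4 := kS.Z_mul_comm kS.ι_mul
  have r5 := kS.S.Z_mul_comm kι
  have r6 := kι.S.Z_mul_comm kS
  have q1 := congrArg (fun x => Z (ι ^ 2 * x)) S_one_sq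
  have q2 := congrArg (fun x => Z (S ι * x)) S_one_sq
  have q3 := congrArg (fun x => Z (ι * x)) S_one_mul_S_ι
  have q4 := congrArg (fun x => Z (ι * x)) S_one_mul_S_S_one
  have q5 := congrArg Z S_ι_sq
  have q6 := congrArg Z S_one_sq
  have goal_eq : (S 1 + ι) ^ 2 * (S ι + ι ^ 2) = S ι * S 1 ^ 2 + 2 * (ι * (S 1 * S ι)) +
      ι ^ 2 * S ι + ι ^ 2 * S 1 ^ 2 + 2 * (ι ^ 3 * S 1) + ι ^ 4 := by ring
  rw [goal_eq]
  simp only [mul_add, mul_sub, map_add, map_sub, map_smul, smul_eq_mul, mul_one, one_mul,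
    mul_smul_comm, mul_left_comm _ (2 : slow), mul_left_comm _ (3 : slow),
    Z_two_mul, Z_three_mul] at p1 p2 p3 p4 p5 r1 r2 r3 r4 r5 r6 q1 q2 q3 q4 q5 q6 ⊢
  ring_nf at p1 p2 p3 p4 p5 r1 r2 r3 r4 r5 r6 q1 q2 q3 q4 q5 q6 m21 m22 m31 m211 hz sf ⊢
  simp only [m21, m22, m31, m211] at p1 p2 p3 p4 p5 r1 r2 r3 r4 r5 r6 q1 q2 q3 q4 q5 q6
  simp only [q6] at r6
  linarith

lemma coe_S_one_add_ι (k : ℕ) : (S 1 + ι).1 k = H (k + 1) := by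
  rw [coe_add, coe_S, coe_ι, H, Finset.sum_range_succ]
  rfl

lemma coe_S_ι_add_ι_sq (k : ℕ) : (S ι + ι ^ 2).1 k = H2 (k + 1) := by
  rw [coe_add, coe_S, coe_ι_pow, H2, Finset.sum_range_succ]
  simp only [coe_ι, div_div, sq]

end HarmonicSeries

open HarmonicSeries in
theorem stmt14 :
    HasSum (fun k : ℕ => (H (k + 1)) ^ 2 * H2 (k + 1) / ((k : ℝ) + 1) ^ 2)
      ((41 / 12) * zeta 6 + 2 * (zeta 3) ^ 2) := by
  have h3 : Z ι = zeta 3 := by simpa using Z_ι_pow 1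
  have hs := hasSum_Z ((S 1 + ι) ^ 2 * (S ι + ι ^ 2))
  rw [Z_target, Z_ι_pow, h3] at hs
  refine hs.congr_fun fun k => ?_
  rw [coe_mul, sq (S 1 + ι), coe_mul, coe_S_one_add_ι, coe_S_ι_add_ι_sq, ← sq]
end
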